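/- arXiv:2301.12933 — 3 statements merged into one kernel-verified Lean document; each statement's English description precedes it below -/
import Mathlib

section
/- If G and H are connected graphs, then λ_3(G □ H) ≥ λ_3(G) + λ_3(H). -/
open SimpleGraph

/-- `T` is an `S`-Steiner tree in `G`: a subgraph of `G` that is a tree containing `S`. -/
def IsSteinerTree {V : Type*} (G : SimpleGraph V) (S : Set V) (T : G.Subgraph) : Prop :=
  S ⊆ T.verts ∧ T.coe.IsTree

/-- There exist `n` pairwise edge-disjoint `S`-Steiner trees in `G`. -/
def HasEDSteinerTrees {V : Type*} (G : SimpleGraph V) (S : Set V) (n : ℕ) : Prop :=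
  ∃ f : Fin n → G.Subgraph, (∀ i, IsSteinerTree G S (f i)) ∧
    ∀ i j, i ≠ j → Disjoint (f i).edgeSet (f j).edgeSet

/-- Generalized local edge-connectivity: max number of pairwise edge-disjoint S-Steiner trees. -/
noncomputable def steinerLambda {V : Type*} (G : SimpleGraph V) (S : Set V) : ℕ :=
  sSup {n | HasEDSteinerTrees G S n}

/-- Generalized k-edge-connectivity. -/
noncomputable def genLambda {V : Type*} [Fintype V] (G : SimpleGraph V) (k : ℕ) : ℕ :=
  sInf {m | ∃ S : Finset V, S.card = k ∧ steinerLambda G ↑S = m}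

/-- Ordinary edge-connectivity ("cut" version). -/
noncomputable def edgeConn {V : Type*} [Fintype V] (G : SimpleGraph V) : ℕ :=
  sInf {n | ∃ M : Finset (Sym2 V), M.card = n ∧ ↑M ⊆ G.edgeSet ∧
    ¬ (G.deleteEdges ↑M).Connected}

/-- Minimum degree. -/
noncomputable def minDeg {V : Type*} [Fintype V] (G : SimpleGraph V) : ℕ :=
  @SimpleGraph.minDegree V G _ (Classical.decRel _)

/-- There exist `n` pairwise edge-disjoint spanning trees of `G`. -/
def HasEDSpanningTrees {V : Type*} (G : SimpleGraph V) (n : ℕ) : Prop :=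
  ∃ f : Fin n → G.Subgraph, (∀ i, (f i).IsSpanning ∧ (f i).coe.IsTree) ∧
    ∀ i j, i ≠ j → Disjoint (f i).edgeSet (f j).edgeSet

/-- Maximum number of pairwise edge-disjoint spanning trees. -/
noncomputable def spanningTreePacking {V : Type*} (G : SimpleGraph V) : ℕ :=
  sSup {n | HasEDSpanningTrees G n}


/-- A family of pairwise edge-disjoint spanning subgraphs, each connecting `S`. -/
def Pack {V ι : Type*} (G : SimpleGraph V) (S : Set V) (F : ι → SimpleGraph V) : Prop :=
  (∀ i u v, (F i).Adj u v → G.Adj u v) ∧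
  (∀ i j, i ≠ j → ∀ u v, (F i).Adj u v → ¬ (F j).Adj u v) ∧
  ∀ i, ∀ u ∈ S, ∀ v ∈ S, (F i).Reachable u v

lemma exists_adj_of_reachable {V : Type*} {F : SimpleGraph V} {u v : V}
    (h : F.Reachable u v) (hne : u ≠ v) : ∃ w, F.Adj u w := by
  obtain ⟨p⟩ := h
  cases p with
  | nil => exact absurd rfl hne
  | cons h _ => exact ⟨_, h⟩

lemma mem_of_reachable {V : Type*} {F : SimpleGraph V} {u v : V} (P : V → Prop)
    (hP : ∀ x y, P x → F.Adj x y → P y) (h : F.Reachable u v) (hu : P u) : P v := by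
  obtain ⟨p⟩ := h
  induction p with
  | nil => exact hu
  | cons h _ ih => exact ih (hP _ _ hu h)

lemma steiner_pack {V : Type*} {G : SimpleGraph V} {S : Set V} {n : ℕ}
    (h : HasEDSteinerTrees G S n) : ∃ F : Fin n → SimpleGraph V, Pack G S F := by
  obtain ⟨f, hf, hd⟩ := h
  refine ⟨fun i => (f i).spanningCoe, ?_, ?_, ?_⟩
  · intro i u v h
    exact (f i).adj_sub h
  · intro i j hij u v h1 h2
    have hdis := Set.disjoint_left.1 (hd i j hij)
    exact hdis (show s(u, v) ∈ (f i).edgeSet from h1) h2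
  · intro i u hu v hv
    have hc := (hf i).2.connected.preconnected ⟨u, (hf i).1 hu⟩ ⟨v, (hf i).1 hv⟩
    exact hc.map (f i).coeEmbeddingSpanningCoe.toHom

lemma pack_steiner {V : Type*} {G : SimpleGraph V} {S : Set V} {n : ℕ}
    {s : V} (hs : s ∈ S)
    {F : Fin n → SimpleGraph V} (h : Pack G S F) : HasEDSteinerTrees G S n := by
  obtain ⟨h1, h2, h3⟩ := h
  have key : ∀ i, ∃ T : G.Subgraph, IsSteinerTree G S T ∧ ∀ u v, T.Adj u v → (F i).Adj u v := by
    intro i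
    have hconn := ((F i).connectedComponentMk s).connected_toSimpleGraph
    obtain ⟨T, hTle, hT⟩ := hconn.exists_isTree_le
    let T' : G.Subgraph :=
      { verts := {v | v ∈ (F i).connectedComponentMk s}
        Adj := fun u v => ∃ hu hv, T.Adj ⟨u, hu⟩ ⟨v, hv⟩
        adj_sub := by
          rintro u v ⟨hu, hv, h⟩
          exact h1 i u v (hTle h)
        edge_vert := by
          rintro u v ⟨hu, hv, h⟩
          exact hu
        symm := ⟨by
          rintro u v ⟨hu, hv, h⟩
          exact ⟨hv, hu, h.symm⟩⟩ }
    have hco : T'.coe = T := by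
      ext u v
      constructor
      · rintro ⟨_, _, h⟩
        exact h
      · intro h
        exact ⟨u.2, v.2, h⟩
    refine ⟨T', ⟨?_, ?_⟩, ?_⟩
    · intro v hv
      change (F i).connectedComponentMk v = _
      exact ConnectedComponent.sound (h3 i v hv s hs)
    · rw [hco]
      exact hT
    · rintro u v ⟨hu, hv, h⟩
      exact hTle h
  choose f hf hf' using key
  refine ⟨f, hf, ?_⟩
  intro i j hij
  rw [Set.disjoint_left]
  intro e
  induction e with | _ u v =>
  intro he he'
  exact h2 i j hij u v (hf' i u v he) (hf' j u v he')

lemma pack_le {V ι : Type*} [Fintype V] [Fintype ι] {G : SimpleGraph V} {S : Set V}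
    {s t : V} (hs : s ∈ S) (ht : t ∈ S) (hst : s ≠ t)
    {F : ι → SimpleGraph V} (h : Pack G S F) : Fintype.card ι ≤ steinerLambda G S := by
  classical
  refine le_csSup ?_ ?_
  · refine ⟨Fintype.card (Sym2 V), ?_⟩
    intro n hn
    obtain ⟨F, -, h2, h3⟩ := steiner_pack hn
    have : ∀ i, ∃ w, (F i).Adj s w := fun i => exists_adj_of_reachable (h3 i s hs t ht) hst
    choose w hw using this
    have hinj : Function.Injective (fun i => s(s, w i)) := by
      intro i j hij
      by_contra hne
      have : w i = w j := Sym2.congr_right.1 hij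
      exact h2 i j hne s (w i) (hw i) (this ▸ hw j)
    simpa using Fintype.card_le_of_injective _ hinj
  · let e := Fintype.equivFin ι
    refine pack_steiner hs (F := fun i => F (e.symm i)) ⟨fun i => h.1 _, ?_, fun i => h.2.2 _⟩
    intro i j hij
    exact h.2.1 _ _ (fun hh => hij (e.symm.injective hh))

lemma genLambda_pack {V : Type*} [Fintype V] {G : SimpleGraph V} {a : Fin 3 → V}
    (ha : Function.Injective a) : ∃ n, genLambda G 3 ≤ n ∧
      ∃ F : Fin n → SimpleGraph V, Pack G (Set.range a) F := by
  classical
  refine ⟨steinerLambda G (Set.range a), ?_, ?_⟩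
  · refine Nat.sInf_le ⟨Finset.univ.image a, ?_, ?_⟩
    · rw [Finset.card_image_of_injective _ ha]; simp
    · simp
  · apply steiner_pack
    have h0 : HasEDSteinerTrees G (Set.range a) 0 := ⟨fun i => i.elim0, fun i => i.elim0,
      fun i => i.elim0⟩
    by_cases hb : BddAbove {n | HasEDSteinerTrees G (Set.range a) n}
    · exact Nat.sSup_mem ⟨0, h0⟩ hb
    · have : steinerLambda G (Set.range a) = 0 := by
        unfold steinerLambda
        exact Nat.sSup_of_not_bddAbove hb
      rw [this]; exact h0

lemma pack_pos {V : Type*} [Fintype V] {G : SimpleGraph V} (hG : G.Connected) {a : Fin 3 → V}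
    (ha : Function.Injective a) : ∃ n, genLambda G 3 ≤ n + 1 ∧
      ∃ F : Fin (n + 1) → SimpleGraph V, Pack G (Set.range a) F := by
  obtain ⟨n, hn, F, hF⟩ := genLambda_pack (G := G) ha
  cases n with
  | succ n => exact ⟨n, hn, F, hF⟩
  | zero =>
    refine ⟨0, by omega, fun _ => G, fun _ _ _ h => h, ?_, fun _ u _ v _ => hG.preconnected u v⟩
    intro i j hij
    exact absurd (by omega) hij

lemma base_exists {V ι : Type*} {G : SimpleGraph V} {a : Fin 3 → V}
    (ha : Function.Injective a) {F : ι → SimpleGraph V} (hF : Pack G (Set.range a) F) :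
    ∃ p, ∀ i j, (∀ w, (F i).Adj (a p) w → w ∈ Set.range a) →
      (∀ w, (F j).Adj (a p) w → w ∈ Set.range a) → i = j := by
  by_contra hcon
  push Not at hcon
  obtain ⟨h1, h2, h3⟩ := hF
  have hr : ∀ i p q, (F i).Reachable (a p) (a q) := fun i p q => h3 i _ ⟨p, rfl⟩ _ ⟨q, rfl⟩
  have hadj : ∀ i p, ∃ w, (F i).Adj (a p) w := by
    intro i p
    refine exists_adj_of_reachable (hr i p (p + 1)) ?_
    intro h
    have := ha h
    clear h
    revert this
    revert p
    decide
  have key : ∀ p q, p ≠ q → ∃ i, (F i).Adj (a p) (a q) ∧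
      ∀ w, (F i).Adj (a p) w → w = a q := by
    intro p q hpq
    obtain ⟨i, j, hi, hj, hij⟩ := hcon p
    obtain ⟨w, hw⟩ := hadj i p
    obtain ⟨w', hw'⟩ := hadj j p
    obtain ⟨x, rfl⟩ := hi w hw
    obtain ⟨y, rfl⟩ := hj w' hw'
    have three : ∀ p q x y z : Fin 3, p ≠ q → x ≠ p → y ≠ p → x ≠ y → z ≠ p → z ≠ x → 
      z = y := by decide
    have hxp : x ≠ p := fun h => (F i).loopless.irrefl _ (h ▸ hw)
    have hyp : y ≠ p := fun h => (F j).loopless.irrefl _ (h ▸ hw')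
    have hxy : x ≠ y := fun h => h2 i j hij _ _ hw (h ▸ hw')
    by_cases hq : q = x
    · subst hq
      refine ⟨i, hw, ?_⟩
      intro w hw2
      obtain ⟨z, rfl⟩ := hi w hw2
      have hzp : z ≠ p := fun h => (F i).loopless.irrefl _ (h ▸ hw2)
      have hzy : z ≠ y := fun h => h2 i j hij _ _ hw2 (h ▸ hw')
      rw [three p q y q z hpq hyp hxp hxy.symm hzp hzy]
    · have hqy := three p q x y q hpq hxp hyp hxy hpq.symm hq
      subst hqy
      refine ⟨j, hw', ?_⟩
      intro w hw2
      obtain ⟨z, rfl⟩ := hj w hw2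
      have hzp : z ≠ p := fun h => (F j).loopless.irrefl _ (h ▸ hw2)
      have hzy : z ≠ x := fun h => h2 i j hij _ _ hw (h ▸ hw2)
      rw [three p q x q z hpq hxp hyp hxy hzp hzy]
  obtain ⟨i, hi, hi'⟩ := key 0 1 (by decide)
  obtain ⟨j, hj, hj'⟩ := key 1 0 (by decide)
  have hij : i = j := by
    by_contra hne
    exact h2 i j hne _ _ hi hj.symm
  subst hij
  have := mem_of_reachable (fun x => x = a 0 ∨ x = a 1) (by
    rintro x y (rfl | rfl) h
    · exact Or.inr (hi' _ h)
    · exact Or.inl (hj' _ h)) (hr i 0 2) (Or.inl rfl)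
  rcases this with h | h
  · exact absurd (ha h) (by decide)
  · exact absurd (ha h) (by decide)

/-- The key lemma: one distinguished connecting subgraph, and distinct hubs in the others. -/
lemma key_lemma {V : Type*} [Fintype V] {G : SimpleGraph V} (hG : G.Connected) {a : Fin 3 → V}
    (ha : Function.Injective a) : ∃ n, genLambda G 3 ≤ n + 1 ∧
      ∃ (F : Option (Fin n) → SimpleGraph V) (c : Fin n → V), Pack G (Set.range a) F ∧
        Function.Injective c ∧ (∀ i, c i ∉ Set.range a) ∧
        ∀ i p, (F (some i)).Reachable (a p) (c i) := by
  classical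
  obtain ⟨n, hn, F, hF⟩ := pack_pos hG ha
  obtain ⟨p, hp⟩ := base_exists ha hF
  obtain ⟨i0, hi0⟩ : ∃ i0, ∀ i, i ≠ i0 → ∃ w, (F i).Adj (a p) w ∧ w ∉ Set.range a := by
    by_cases h : ∃ i0, ∀ w, (F i0).Adj (a p) w → w ∈ Set.range a
    · obtain ⟨i0, h0⟩ := h
      refine ⟨i0, fun i hi => ?_⟩
      by_contra hc
      push Not at hc
      exact hi (hp i i0 hc h0)
    · push Not at h
      exact ⟨0, fun i _ => h i⟩
  let e : Option (Fin n) ≃ Fin (n + 1) := (finSuccEquiv' i0).symm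
  have he : ∀ i, e (some i) ≠ i0 := by
    intro i
    simp [e, Fin.succAbove_ne]
  choose c hc hc' using fun i => hi0 (e (some i)) (he i)
  refine ⟨n, hn, fun o => F (e o), c, ⟨fun i => hF.1 _, ?_, fun i => hF.2.2 _⟩, ?_, hc', ?_⟩
  · intro i j hij
    exact hF.2.1 _ _ (fun h => hij (e.injective h))
  · intro i j hij
    by_contra hne
    exact hF.2.1 (e (some i)) (e (some j)) (fun h => hne (by simpa using e.injective h)) _ _
      (hc i) (hij ▸ hc j)
  · intro i q
    exact (hF.2.2 _ _ ⟨q, rfl⟩ _ ⟨p, rfl⟩).trans (hc i).reachable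

/-- Graph on the product given by a graph in every row and a graph in every column. -/
def Grid {α β : Type*} (R : β → SimpleGraph α) (C : α → SimpleGraph β) : SimpleGraph (α × β) where
  Adj x y := (x.2 = y.2 ∧ (R x.2).Adj x.1 y.1) ∨ (x.1 = y.1 ∧ (C x.1).Adj x.2 y.2)
  symm := ⟨by
    rintro ⟨x1, x2⟩ ⟨y1, y2⟩ (⟨h, h'⟩ | ⟨h, h'⟩)
    · left
      simp only at h h' ⊢
      subst h
      exact ⟨rfl, h'.symm⟩
    · right
      simp only at h h' ⊢
      subst h
      exact ⟨rfl, h'.symm⟩⟩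
  loopless := ⟨by
    rintro ⟨x1, x2⟩ (⟨_, h'⟩ | ⟨_, h'⟩)
    · exact (R x2).loopless.irrefl _ h'
    · exact (C x1).loopless.irrefl _ h'⟩

/-- `G` if `P` holds and the empty graph otherwise. -/
def Gate {α : Type*} (P : Prop) (G : SimpleGraph α) : SimpleGraph α where
  Adj x y := P ∧ G.Adj x y
  symm := ⟨fun _ _ h => ⟨h.1, h.2.symm⟩⟩
  loopless := ⟨fun _ h => G.loopless.irrefl _ h.2⟩

lemma gate_eq {α : Type*} {P : Prop} (h : P) (G : SimpleGraph α) : Gate P G = G := by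
  ext x y
  exact ⟨fun h => h.2, fun h' => ⟨h, h'⟩⟩

lemma grid_row {α β : Type*} {R : β → SimpleGraph α} {C : α → SimpleGraph β} {a a' : α} (b : β)
    (h : (R b).Reachable a a') : (Grid R C).Reachable (a, b) (a', b) :=
  h.map (⟨fun x => (x, b), fun h => Or.inl ⟨rfl, h⟩⟩ : (R b) →g Grid R C)

lemma grid_col {α β : Type*} {R : β → SimpleGraph α} {C : α → SimpleGraph β} {b b' : β} (a : α)
    (h : (C a).Reachable b b') : (Grid R C).Reachable (a, b) (a, b') :=
  h.map (⟨fun x => (a, x), fun h => Or.inr ⟨rfl, h⟩⟩ : (C a) →g Grid R C)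

lemma grid_le {α β : Type*} {G : SimpleGraph α} {H : SimpleGraph β}
    {R : β → SimpleGraph α} {C : α → SimpleGraph β}
    (hR : ∀ b u v, (R b).Adj u v → G.Adj u v) (hC : ∀ a u v, (C a).Adj u v → H.Adj u v)
    (x y) (h : (Grid R C).Adj x y) : (G □ H).Adj x y := by
  rw [boxProd_adj]
  rcases h with ⟨h, h'⟩ | ⟨h, h'⟩
  · exact Or.inl ⟨hR _ _ _ h', h⟩
  · exact Or.inr ⟨hC _ _ _ h', h⟩

lemma grid_disj {α β : Type*}
    {R R' : β → SimpleGraph α} {C C' : α → SimpleGraph β}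
    (hR : ∀ b u v, (R b).Adj u v → ¬ (R' b).Adj u v)
    (hC : ∀ a u v, (C a).Adj u v → ¬ (C' a).Adj u v)
    (x y) (h : (Grid R C).Adj x y) : ¬ (Grid R' C').Adj x y := by
  rintro (⟨h2, h2'⟩ | ⟨h2, h2'⟩) <;> rcases h with ⟨h, h'⟩ | ⟨h, h'⟩
  · exact hR _ _ _ h' h2'
  · exact (R' x.2).loopless.irrefl x.1 (by rw [← h] at h2'; exact h2')
  · exact (C' x.1).loopless.irrefl x.2 (by rw [← h] at h2'; exact h2')
  · exact hC _ _ _ h' h2'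

lemma pair_ne {α β : Type*} {S : Finset (α × β)} (hS : S.card = 3) :
    ∃ x ∈ S, ∃ y ∈ S, x ≠ y := by
  exact Finset.one_lt_card.1 (by omega)

lemma cover {α γ : Type*} [Fintype α] (f : γ → α) {S : Finset γ} (hS : S.card = 3)
    (h : 3 ≤ Fintype.card α) :
    ∃ a : Fin 3 → α, Function.Injective a ∧ ∀ x ∈ S, ∃ p, a p = f x := by
  classical
  obtain ⟨t, ht, hc⟩ := Finset.exists_superset_card_eq (s := S.image f) (n := 3)
    (hS ▸ Finset.card_image_le) h
  refine ⟨fun p => (t.equivFinOfCardEq hc).symm p, ?_, ?_⟩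
  · intro p q hpq
    simpa using hpq
  · intro x hx
    exact ⟨t.equivFinOfCardEq hc ⟨f x, ht (Finset.mem_image_of_mem f hx)⟩, by simp⟩

lemma small_left {α β : Type*} [Fintype α] [Fintype β]
    {G : SimpleGraph α} {H : SimpleGraph β} (hG : G.Connected) (hH : H.Connected)
    {S : Finset (α × β)} (hS : S.card = 3) (hb : 3 ≤ Fintype.card β) :
    genLambda H 3 ≤ steinerLambda (G □ H) S := by
  classical
  obtain ⟨b, hbi, hbS⟩ := cover Prod.snd hS hb
  obtain ⟨n, hn, U, d, hU, hd, hd', hr⟩ := key_lemma hH hbi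
  obtain ⟨x, hx, y, hy, hxy⟩ := pair_ne hS
  let D : Option (Fin n) → β := fun o => o.elim (b 0) d
  have hD : Function.Injective D := by
    rintro (_ | i) (_ | j) h
    · rfl
    · exact absurd ⟨0, h⟩ (hd' j)
    · exact absurd ⟨0, h.symm⟩ (hd' i)
    · exact congrArg some (hd h)
  have hDr : ∀ o p, (U o).Reachable (b p) (D o) := by
    rintro (_ | i) p
    · exact hU.2.2 _ _ ⟨p, rfl⟩ _ ⟨0, rfl⟩
    · exact hr i p
  have hP : Pack (G □ H) (S : Set (α × β))
      (fun o => Grid (fun b0 => Gate (b0 = D o) G) (fun _ => U o)) := by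
    refine ⟨fun o => grid_le (fun _ _ _ h => h.2) (fun _ => hU.1 o), ?_, ?_⟩
    · intro i j hij
      refine grid_disj ?_ (fun _ => hU.2.1 i j hij)
      intro b0 u v h1 h2
      exact hij (hD (h1.1.symm.trans h2.1))
    · have hub : ∀ o, ∀ u ∈ S, (Grid (fun b0 => Gate (b0 = D o) G) (fun _ => U o)).Reachable
          u (x.1, D o) := by
        rintro o ⟨u1, u2⟩ hu
        obtain ⟨p, hp⟩ := hbS _ hu
        simp only at hp
        subst hp
        refine (grid_col u1 (hDr o p)).trans (grid_row (D o) ?_)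
        rw [gate_eq rfl]
        exact hG.preconnected _ _
      intro o u hu v hv
      exact (hub o u hu).trans (hub o v hv).symm
  have := pack_le (s := x) (t := y) hx hy hxy hP
  simp at this
  omega

lemma small_right {α β : Type*} [Fintype α] [Fintype β]
    {G : SimpleGraph α} {H : SimpleGraph β} (hG : G.Connected) (hH : H.Connected)
    {S : Finset (α × β)} (hS : S.card = 3) (ha : 3 ≤ Fintype.card α) :
    genLambda G 3 ≤ steinerLambda (G □ H) S := by
  classical
  obtain ⟨a, hai, haS⟩ := cover Prod.fst hS ha
  obtain ⟨n, hn, T, c, hT, hc, hc', hr⟩ := key_lemma hG hai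
  obtain ⟨x, hx, y, hy, hxy⟩ := pair_ne hS
  let D : Option (Fin n) → α := fun o => o.elim (a 0) c
  have hD : Function.Injective D := by
    rintro (_ | i) (_ | j) h
    · rfl
    · exact absurd ⟨0, h⟩ (hc' j)
    · exact absurd ⟨0, h.symm⟩ (hc' i)
    · exact congrArg some (hc h)
  have hDr : ∀ o p, (T o).Reachable (a p) (D o) := by
    rintro (_ | i) p
    · exact hT.2.2 _ _ ⟨p, rfl⟩ _ ⟨0, rfl⟩
    · exact hr i p
  have hP : Pack (G □ H) (S : Set (α × β))
      (fun o => Grid (fun _ => T o) (fun a0 => Gate (a0 = D o) H)) := by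
    refine ⟨fun o => grid_le (fun _ => hT.1 o) (fun _ _ _ h => h.2), ?_, ?_⟩
    · intro i j hij
      refine grid_disj (fun _ => hT.2.1 i j hij) ?_
      intro b0 u v h1 h2
      exact hij (hD (h1.1.symm.trans h2.1))
    · have hub : ∀ o, ∀ u ∈ S, (Grid (fun _ => T o) (fun a0 => Gate (a0 = D o) H)).Reachable
          u (D o, x.2) := by
        rintro o ⟨u1, u2⟩ hu
        obtain ⟨p, hp⟩ := haS _ hu
        simp only at hp
        subst hp
        refine (grid_row u2 (hDr o p)).trans (grid_col (D o) ?_)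
        rw [gate_eq rfl]
        exact hH.preconnected _ _
      intro o u hu v hv
      exact (hub o u hu).trans (hub o v hv).symm
  have := pack_le (s := x) (t := y) hx hy hxy hP
  simp at this
  omega

lemma crossing : ∀ p p' p'' q q' q'' : Fin 3, (p = p' ∧ p = p'') ∨ (q = q' ∧ q = q'') ∨
    ∃ x y : Fin 3, (p = x ↔ q = y) ∧ (p' = x ↔ q' = y) ∧ (p'' = x ↔ q'' = y) := by
  decide

lemma exists_ne_fin : ∀ p : Fin 3, ∃ x, x ≠ p := by decide

/-- Colouring of the lines of a `3 × 3` grid with three marked points. -/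
lemma colouring : ∀ p q p' q' p'' q'' : Fin 3, ∃ r c : Fin 3 → Bool,
    (c p = !r q ∧ c p' = !r q' ∧ c p'' = !r q'') ∧
    ∀ t : Bool, (∃ y x, r y = t ∧ c x = t) ∨ (∃ x, c x = t ∧ p = x ∧ p' = x ∧ p'' = x) ∨
      (∃ y, r y = t ∧ q = y ∧ q' = y ∧ q'' = y) := by
  intro p q p' q' p'' q''
  rcases crossing p p' p'' q q' q'' with ⟨rfl, rfl⟩ | ⟨rfl, rfl⟩ | ⟨x, y, h1, h2, h3⟩
  · obtain ⟨x, hx⟩ := exists_ne_fin p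
    refine ⟨fun _ => false, fun z => decide (z = p), by simp, ?_⟩
    rintro (_ | _)
    · exact Or.inl ⟨0, x, by simp [hx]⟩
    · exact Or.inr (Or.inl ⟨p, by simp⟩)
  · obtain ⟨y, hy⟩ := exists_ne_fin q
    refine ⟨fun z => decide (z = q), fun _ => false, by simp, ?_⟩
    rintro (_ | _)
    · exact Or.inl ⟨y, 0, by simp [hy]⟩
    · exact Or.inr (Or.inr ⟨q, by simp⟩)
  · obtain ⟨x', hx⟩ := exists_ne_fin x
    obtain ⟨y', hy⟩ := exists_ne_fin y
    refine ⟨fun z => decide (z = y), fun z => !decide (z = x), by simp [h1, h2, h3], ?_⟩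
    rintro (_ | _)
    · exact Or.inl ⟨y', x, by simp [hy]⟩
    · exact Or.inl ⟨y, x', by simp [hx]⟩

lemma big {α β : Type*} [Fintype α] [Fintype β]
    {G : SimpleGraph α} {H : SimpleGraph β} (hG : G.Connected) (hH : H.Connected)
    {S : Finset (α × β)} (hS : S.card = 3) (ha : 3 ≤ Fintype.card α) (hb : 3 ≤ Fintype.card β) :
    genLambda G 3 + genLambda H 3 ≤ steinerLambda (G □ H) S := by
  classical
  obtain ⟨a, hai, haS⟩ := cover Prod.fst hS ha
  obtain ⟨b, hbi, hbS⟩ := cover Prod.snd hS hb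
  obtain ⟨m, hm, T, c, hT, hc, hc', hcr⟩ := key_lemma hG hai
  obtain ⟨n, hn, U, d, hU, hd, hd', hdr⟩ := key_lemma hH hbi
  obtain ⟨x, hx, y, hy, hxy⟩ := pair_ne hS
  -- the colouring of the grid
  obtain ⟨r, k, hrk, ht⟩ : ∃ r k : Fin 3 → Bool, (∀ p q, (a p, b q) ∈ S → k p = !r q) ∧
      ∀ t : Bool, (∃ y x, r y = t ∧ k x = t) ∨ (∃ x, k x = t ∧ ∀ p q, (a p, b q) ∈ S → p = x) ∨
      (∃ y, r y = t ∧ ∀ p q, (a p, b q) ∈ S → q = y) := by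
    obtain ⟨u, v, w, -, -, -, rfl⟩ := Finset.card_eq_three.1 hS
    obtain ⟨p, hp⟩ := haS u (by simp)
    obtain ⟨p', hp'⟩ := haS v (by simp)
    obtain ⟨p'', hp''⟩ := haS w (by simp)
    obtain ⟨q, hq⟩ := hbS u (by simp)
    obtain ⟨q', hq'⟩ := hbS v (by simp)
    obtain ⟨q'', hq''⟩ := hbS w (by simp)
    obtain ⟨r, k, hrk, ht⟩ := colouring p q p' q' p'' q''
    have hmem : ∀ x y, (a x, b y) ∈ ({u, v, w} : Finset (α × β)) →
        (x = p ∧ y = q) ∨ (x = p' ∧ y = q') ∨ (x = p'' ∧ y = q'') := by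
      intro x y h
      simp only [Finset.mem_insert, Finset.mem_singleton] at h
      rcases h with rfl | rfl | rfl
      · exact Or.inl ⟨(hai hp).symm, (hbi hq).symm⟩
      · exact Or.inr (Or.inl ⟨(hai hp').symm, (hbi hq').symm⟩)
      · exact Or.inr (Or.inr ⟨(hai hp'').symm, (hbi hq'').symm⟩)
    refine ⟨r, k, ?_, ?_⟩
    · intro x y h
      rcases hmem x y h with ⟨rfl, rfl⟩ | ⟨rfl, rfl⟩ | ⟨rfl, rfl⟩
      exacts [hrk.1, hrk.2.1, hrk.2.2]
    · intro t
      rcases ht t with h | ⟨z, h1, h2, h3, h4⟩ | ⟨z, h1, h2, h3, h4⟩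
      · exact Or.inl h
      · refine Or.inr (Or.inl ⟨z, h1, ?_⟩)
        intro x y h
        rcases hmem x y h with ⟨rfl, rfl⟩ | ⟨rfl, rfl⟩ | ⟨rfl, rfl⟩ <;> assumption
      · refine Or.inr (Or.inr ⟨z, h1, ?_⟩)
        intro x y h
        rcases hmem x y h with ⟨rfl, rfl⟩ | ⟨rfl, rfl⟩ | ⟨rfl, rfl⟩ <;> assumption
  have hTr : ∀ p q, (T none).Reachable (a p) (a q) :=
    fun p q => hT.2.2 _ _ ⟨p, rfl⟩ _ ⟨q, rfl⟩
  have hUr : ∀ p q, (U none).Reachable (b p) (b q) :=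
    fun p q => hU.2.2 _ _ ⟨p, rfl⟩ _ ⟨q, rfl⟩
  have hSab : ∀ u ∈ S, ∃ p q, u = (a p, b q) := by
    rintro ⟨u1, u2⟩ hu
    obtain ⟨p, hp⟩ := haS _ hu
    obtain ⟨q, hq⟩ := hbS _ hu
    exact ⟨p, q, by simp [hp, hq]⟩
  let R : Bool ⊕ Fin m ⊕ Fin n → β → SimpleGraph α := fun s b0 =>
    match s with
    | .inl t => Gate (∃ q, b q = b0 ∧ r q = t) (T none)
    | .inr (.inl i) => Gate (b0 ∈ Set.range b) (T (some i))
    | .inr (.inr j) => Gate (b0 = d j) G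
  let C : Bool ⊕ Fin m ⊕ Fin n → α → SimpleGraph β := fun s a0 =>
    match s with
    | .inl t => Gate (∃ p, a p = a0 ∧ k p = t) (U none)
    | .inr (.inl i) => Gate (a0 = c i) H
    | .inr (.inr j) => Gate (a0 ∈ Set.range a) (U (some j))
  have hP : Pack (G □ H) (S : Set (α × β)) (fun s => Grid (R s) (C s)) := by
    refine ⟨fun s => grid_le ?_ ?_, fun s s' hs => grid_disj ?_ ?_, fun s => ?_⟩
    · rintro b0 u v h
      rcases s with t | i | j
      exacts [hT.1 _ _ _ h.2, hT.1 _ _ _ h.2, h.2]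
    · rintro a0 u v h
      rcases s with t | i | j
      exacts [hU.1 _ _ _ h.2, h.2, hU.1 _ _ _ h.2]
    · rintro b0 u v h h'
      rcases s with t | i | j <;> rcases s' with t' | i' | j'
      · obtain ⟨⟨q, hq, hq1⟩, -⟩ := h
        obtain ⟨⟨q', hq', hq1'⟩, -⟩ := h'
        have : q = q' := hbi (hq.trans hq'.symm)
        subst this
        exact hs (by rw [← hq1, ← hq1'])
      · exact hT.2.1 _ _ (by simp) _ _ h.2 h'.2
      · obtain ⟨⟨q, hq, hq1⟩, -⟩ := h
        exact hd' j' ⟨q, hq.trans h'.1⟩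
      · exact hT.2.1 _ _ (by simp) _ _ h.2 h'.2
      · exact hT.2.1 _ _ (by simpa using hs) _ _ h.2 h'.2
      · exact hd' j' (h'.1 ▸ h.1)
      · obtain ⟨⟨q, hq, hq1⟩, -⟩ := h'
        exact hd' j ⟨q, hq.trans h.1⟩
      · exact hd' j (h.1 ▸ h'.1)
      · exact hs (by rw [hd (h.1.symm.trans h'.1)])
    · rintro a0 u v h h'
      rcases s with t | i | j <;> rcases s' with t' | i' | j'
      · obtain ⟨⟨q, hq, hq1⟩, -⟩ := h
        obtain ⟨⟨q', hq', hq1'⟩, -⟩ := h'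
        have : q = q' := hai (hq.trans hq'.symm)
        subst this
        exact hs (by rw [← hq1, ← hq1'])
      · obtain ⟨⟨q, hq, hq1⟩, -⟩ := h
        exact hc' i' ⟨q, hq.trans h'.1⟩
      · exact hU.2.1 _ _ (by simp) _ _ h.2 h'.2
      · obtain ⟨⟨q, hq, hq1⟩, -⟩ := h'
        exact hc' i ⟨q, hq.trans h.1⟩
      · exact hs (by rw [hc (h.1.symm.trans h'.1)])
      · exact hc' i (h.1 ▸ h'.1)
      · exact hU.2.1 _ _ (by simp) _ _ h.2 h'.2
      · exact hc' i' (h'.1 ▸ h.1)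
      · exact hU.2.1 _ _ (by simpa using hs) _ _ h.2 h'.2
    · suffices hh : ∃ z, ∀ u ∈ S, (Grid (R s) (C s)).Reachable u z by
        obtain ⟨z, hz⟩ := hh
        exact fun u hu v hv => (hz u hu).trans (hz v hv).symm
      rcases s with t | i | j
      · have hrow : ∀ q, r q = t → ∀ p p', (Grid (R (.inl t)) (C (.inl t))).Reachable
            (a p, b q) (a p', b q) := by
          intro q hq p p'
          refine grid_row _ ?_
          change (Gate _ _).Reachable _ _
          rw [gate_eq ⟨q, rfl, hq⟩]
          exact hTr p p'
        have hcol : ∀ p, k p = t → ∀ q q', (Grid (R (.inl t)) (C (.inl t))).Reachable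
            (a p, b q) (a p, b q') := by
          intro p hp q q'
          refine grid_col _ ?_
          change (Gate _ _).Reachable _ _
          rw [gate_eq ⟨p, rfl, hp⟩]
          exact hUr q q'
        rcases ht t with ⟨y, x, hy, hx⟩ | ⟨x, hx, hh⟩ | ⟨y, hy, hh⟩
        · refine ⟨(a x, b y), fun u hu => ?_⟩
          obtain ⟨p, q, rfl⟩ := hSab u hu
          have h1 := hrk p q hu
          by_cases hq : r q = t
          · exact (hrow q hq p x).trans (hcol x hx q y)
          · have hp : k p = t := by
              rw [h1]
              revert hq
              cases r q <;> cases t <;> simp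
            exact (hcol p hp q y).trans (hrow y hy p x)
        · refine ⟨(a x, b 0), fun u hu => ?_⟩
          obtain ⟨p, q, rfl⟩ := hSab u hu
          have := hh p q hu
          subst this
          exact hcol p hx q 0
        · refine ⟨(a 0, b y), fun u hu => ?_⟩
          obtain ⟨p, q, rfl⟩ := hSab u hu
          have := hh p q hu
          subst this
          exact hrow q hy p 0
      · refine ⟨(c i, b 0), fun u hu => ?_⟩
        obtain ⟨p, q, rfl⟩ := hSab u hu
        refine (grid_row (a' := c i) _ ?_).trans (grid_col _ ?_)
        · change (Gate _ _).Reachable _ _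
          rw [gate_eq ⟨q, rfl⟩]
          exact hcr i p
        · change (Gate _ _).Reachable _ _
          rw [gate_eq rfl]
          exact hH.preconnected _ _
      · refine ⟨(a 0, d j), fun u hu => ?_⟩
        obtain ⟨p, q, rfl⟩ := hSab u hu
        refine (grid_col (b' := d j) _ ?_).trans (grid_row _ ?_)
        · change (Gate _ _).Reachable _ _
          rw [gate_eq ⟨p, rfl⟩]
          exact hdr j q
        · change (Gate _ _).Reachable _ _
          rw [gate_eq rfl]
          exact hG.preconnected _ _
  have := pack_le (s := x) (t := y) hx hy hxy hP
  simp at this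
  omega

lemma genLambda_small {V : Type*} [Fintype V] (G : SimpleGraph V) (h : Fintype.card V < 3) :
    genLambda G 3 = 0 := by
  have : {m | ∃ S : Finset V, S.card = 3 ∧ steinerLambda G ↑S = m} = ∅ := by
    ext m
    simp only [Set.mem_ofPred_eq, Set.mem_empty_iff_false, iff_false]
    rintro ⟨S, hS, -⟩
    have := S.card_le_univ
    omega
  unfold genLambda
  rw [this]
  exact Nat.sInf_empty

/-- λ₃(G □ H) ≥ λ₃(G) + λ₃(H) for connected G, H. -/
theorem stmt2 {α β : Type*} [Fintype α] [Fintype β]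
    (G : SimpleGraph α) (H : SimpleGraph β)
    (hG : G.Connected) (hH : H.Connected) :
    genLambda G 3 + genLambda H 3 ≤ genLambda (G □ H) 3 := by
  classical
  have hα := hG.nonempty
  have hβ := hH.nonempty
  have pa : 0 < Fintype.card α := Fintype.card_pos
  have pb : 0 < Fintype.card β := Fintype.card_pos
  by_cases hne : {m | ∃ S : Finset (α × β), S.card = 3 ∧ steinerLambda (G □ H) ↑S = m}.Nonempty
  · refine le_csInf hne ?_
    rintro m ⟨S, hS, rfl⟩
    rcases Nat.lt_or_ge (Fintype.card α) 3 with h1 | h1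
    · rw [genLambda_small G h1, Nat.zero_add]
      rcases Nat.lt_or_ge (Fintype.card β) 3 with h2 | h2
      · rw [genLambda_small H h2]
        exact Nat.zero_le _
      · exact small_left hG hH hS h2
    · rcases Nat.lt_or_ge (Fintype.card β) 3 with h2 | h2
      · rw [genLambda_small H h2]
        exact small_right hG hH hS h1
      · exact big hG hH hS h1 h2
  · have hlt : Fintype.card (α × β) < 3 := by
      by_contra hc
      obtain ⟨S, -, hS⟩ := Finset.exists_subset_card_eq (s := (Finset.univ : Finset (α × β)))
        (n := 3) (by rw [Finset.card_univ]; omega)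
      exact hne ⟨_, S, hS, rfl⟩
    rw [Fintype.card_prod] at hlt
    rw [genLambda_small G (by nlinarith), genLambda_small H (by nlinarith)]
    exact Nat.zero_le _
end

section
/- Let k ≥ 2 be an integer and let G and H be connected graphs each with at least k+1 vertices. If λ_k(H) ≥ λ_k(G) ≥ ⌊k/2⌋, then λ_k(G □ H) ≥ λ_k(G) + λ_k(H). -/
open SimpleGraph

namespace S5

/-- `F` has all its edges inside `X` and connects `X`. -/
def Spans {V : Type*} (F : SimpleGraph V) (X : Set V) : Prop :=
  (∀ x y, F.Adj x y → x ∈ X) ∧ (∀ x ∈ X, ∀ y ∈ X, F.Reachable x y)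

theorem disjoint_of_adj {V : Type*} {F K : SimpleGraph V}
    (h : ∀ x y, F.Adj x y → K.Adj x y → False) : Disjoint F K := by
  rw [disjoint_iff_inf_le]
  intro x y hxy
  exact (h x y hxy.1 hxy.2).elim

theorem adj_of_disjoint {V : Type*} {F K : SimpleGraph V} (h : Disjoint F K) {x y : V}
    (h1 : F.Adj x y) (h2 : K.Adj x y) : False := by
  rw [disjoint_iff_inf_le] at h
  exact h (show (F ⊓ K).Adj x y from ⟨h1, h2⟩)

theorem extract {V : Type*} {G : SimpleGraph V} {S : Set V} {n : ℕ}
    (h : HasEDSteinerTrees G S n) :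
    ∃ (F : Fin n → SimpleGraph V) (X : Fin n → Set V), (∀ i, F i ≤ G) ∧ (∀ i, S ⊆ X i) ∧
      (∀ i, Spans (F i) (X i)) ∧ (∀ i j, i ≠ j → Disjoint (F i) (F j)) := by
  obtain ⟨f, hf, hd⟩ := h
  refine ⟨fun i => (f i).spanningCoe, fun i => (f i).verts, fun i => (f i).spanningCoe_le,
    fun i => (hf i).1, fun i => ⟨fun x y hxy => ?_, fun x hx y hy => ?_⟩, fun i j hij => ?_⟩
  · exact (f i).edge_vert hxy
  · have := (hf i).2.1.preconnected ⟨x, hx⟩ ⟨y, hy⟩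
    exact this.map (f i).coeEmbeddingSpanningCoe.toHom
  · apply disjoint_of_adj
    intro x y h1 h2
    have := hd i j hij
    rw [Set.disjoint_left] at this
    exact this (a := s(x, y)) h1 h2

/-- a family of disjoint connected graphs -/
def HasF {V : Type*} (K : SimpleGraph V) (S : Set V) (n : ℕ) : Prop :=
  ∃ F : Fin n → SimpleGraph V, (∀ i, F i ≤ K) ∧ (∀ i j, i ≠ j → Disjoint (F i) (F j)) ∧
    ∀ i, ∀ x ∈ S, ∀ y ∈ S, (F i).Reachable x y

theorem exists_tree {V : Type*} {G F : SimpleGraph V} (hle : F ≤ G) {S : Set V} {x0 : V}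
    (h0 : x0 ∈ S) (hr : ∀ x ∈ S, ∀ y ∈ S, F.Reachable x y) :
    ∃ T : G.Subgraph, IsSteinerTree G S T ∧ ∀ x y, T.Adj x y → F.Adj x y := by
  let C := F.connectedComponentMk x0
  have hC : C.toSimpleGraph.Connected := C.connected_toSimpleGraph
  obtain ⟨T, hT, hTt⟩ := hC.exists_isTree_le
  have hadj : ∀ x y : C.supp, T.Adj x y → F.Adj x y := fun x y hxy => by
    have := hT hxy
    exact this
  let T' : G.Subgraph :=
    { verts := C.supp
      Adj := fun x y => ∃ (hx : x ∈ C.supp) (hy : y ∈ C.supp), T.Adj ⟨x, hx⟩ ⟨y, hy⟩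
      adj_sub := fun ⟨hx, hy, h⟩ => hle (hadj _ _ h)
      edge_vert := fun ⟨hx, hy, h⟩ => hx
      symm := ⟨fun x y ⟨hx, hy, h⟩ => ⟨hy, hx, h.symm⟩⟩ }
  refine ⟨T', ⟨fun x hx => ?_, ?_⟩, fun x y ⟨hx, hy, h⟩ => hadj _ _ h⟩
  · change F.connectedComponentMk x = C
    exact SimpleGraph.ConnectedComponent.eq.2 (hr x hx x0 h0)
  · have : T'.coe = T := by
      ext x y
      simp [T', SimpleGraph.Subgraph.coe_adj]
    rw [this]
    exact hTt

theorem build {V : Type*} {G : SimpleGraph V} {S : Set V} {n : ℕ} (hS : S.Nonempty)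
    (h : HasF G S n) : HasEDSteinerTrees G S n := by
  obtain ⟨F, hle, hd, hr⟩ := h
  obtain ⟨x0, h0⟩ := hS
  choose T hT hT' using fun i => exists_tree (hle i) h0 (hr i)
  refine ⟨T, hT, fun i j hij => ?_⟩
  rw [Set.disjoint_left]
  intro e
  induction e using Sym2.ind with
  | _ x y =>
    intro h1 h2
    exact adj_of_disjoint (hd i j hij) (hT' i x y h1) (hT' j x y h2)

theorem HasF.of_fintype {V ι : Type*} [Fintype ι] {G : SimpleGraph V} {S : Set V} {n : ℕ}
    (hn : Fintype.card ι = n) (F : ι → SimpleGraph V) (hle : ∀ i, F i ≤ G)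
    (hd : ∀ i j, i ≠ j → Disjoint (F i) (F j))
    (hr : ∀ i, ∀ x ∈ S, ∀ y ∈ S, (F i).Reachable x y) : HasF G S n := by
  let e := (Fintype.equivFinOfCardEq hn).symm
  exact ⟨fun i => F (e i), fun i => hle _, fun i j hij => hd _ _ (fun h => hij (e.injective h)),
    fun i => hr _⟩

theorem HasF.swap {α β : Type*} {G : SimpleGraph α} {H : SimpleGraph β} {S : Set (α × β)} {n : ℕ}
    (h : HasF (H □ G) (Prod.swap ⁻¹' S) n) : HasF (G □ H) S n := by
  obtain ⟨F, hle, hd, hr⟩ := h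
  refine ⟨fun i => (F i).comap Prod.swap, fun i x y hxy => ?_, fun i j hij => ?_, fun i x hx y hy => ?_⟩
  · have := hle i hxy
    simp only [SimpleGraph.boxProd_adj, Prod.fst_swap, Prod.snd_swap] at this ⊢
    tauto
  · apply disjoint_of_adj
    intro x y h1 h2
    exact adj_of_disjoint (hd i j hij) h1 h2
  · have := hr i x.swap (by simpa using hx) y.swap (by simpa using hy)
    let f : F i →g (F i).comap Prod.swap := ⟨Prod.swap, fun {a b} hab => by simpa using hab⟩
    simpa [f] using this.map f

theorem bdd {V : Type*} [Fintype V] (G : SimpleGraph V) (S : Finset V) (hS : 2 ≤ S.card) :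
    BddAbove {n | HasEDSteinerTrees G (S : Set V) n} := by
  classical
  refine ⟨Fintype.card (V × V), fun n hn => ?_⟩
  obtain ⟨F, X, hle, hX, hsp, hd⟩ := extract hn
  obtain ⟨x, hx, y, hy, hxy⟩ := Finset.one_lt_card.1 hS
  have : ∀ i, ∃ z, (F i).Adj x z := fun i => by
    have hr := (hsp i).2 x (hX i hx) y (hX i hy)
    obtain ⟨w⟩ := hr
    cases w with
    | nil => exact (hxy rfl).elim
    | cons h _ => exact ⟨_, h⟩
  choose z hz using this
  have hinj : Function.Injective (fun i => (x, z i)) := fun i j hij => by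
    by_contra hne
    have : z i = z j := by simpa using hij
    exact adj_of_disjoint (hd i j hne) (hz i) (this ▸ hz j)
  simpa using Fintype.card_le_of_injective _ hinj

theorem has_genLambda {V : Type*} [Fintype V] (G : SimpleGraph V) {k : ℕ} (hk : 2 ≤ k)
    (S : Finset V) (hS : S.card = k) : HasEDSteinerTrees G (S : Set V) (genLambda G k) := by
  have h1 : HasEDSteinerTrees G (S : Set V) (steinerLambda G S) := by
    refine Nat.sSup_mem ⟨0, ?_⟩ (bdd G S (hS ▸ hk))
    exact ⟨fun i => i.elim0, fun i => i.elim0, fun i => i.elim0⟩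
  have h2 : genLambda G k ≤ steinerLambda G S := Nat.sInf_le ⟨S, hS, rfl⟩
  obtain ⟨f, hf, hd⟩ := h1
  exact ⟨fun i => f (Fin.castLE h2 i), fun i => hf _, fun i j hij => hd _ _ (by simpa using hij)⟩

theorem le_genLambda {V : Type*} [Fintype V] (G : SimpleGraph V) {k n : ℕ} (hk : 2 ≤ k)
    (hc : k ≤ Fintype.card V)
    (h : ∀ S : Finset V, S.card = k → HasF G (S : Set V) n) : n ≤ genLambda G k := by
  have hne : {m | ∃ S : Finset V, S.card = k ∧ steinerLambda G ↑S = m}.Nonempty := by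
    obtain ⟨S, hS, hS'⟩ := Finset.exists_subset_card_eq (s := (Finset.univ : Finset V)) hc
    exact ⟨_, S, hS', rfl⟩
  refine le_csInf hne ?_
  rintro m ⟨S, hS, rfl⟩
  refine le_csSup (bdd G S (hS ▸ hk)) (build ?_ (h S hS))
  have : S.Nonempty := Finset.card_pos.1 (by omega)
  simpa using this

theorem exists_par {V : Type*} {F : SimpleGraph V} {X : Set V} (h : Spans F X) {r : V}
    (hr : r ∈ X) : ∃ (par : V → V) (dep : V → ℕ), par r = r ∧
      ∀ x ∈ X, x ≠ r → F.Adj x (par x) ∧ par x ∈ X ∧ dep (par x) < dep x := by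
  classical
  have : ∀ x : V, ∃ y, (x = r → y = r) ∧
      (x ∈ X → x ≠ r → F.Adj x y ∧ y ∈ X ∧ F.dist y r < F.dist x r) := fun x => by
    by_cases hx : x ∈ X ∧ x ≠ r
    · obtain ⟨w, hw⟩ := (h.2 x hx.1 r hr).exists_walk_length_eq_dist
      cases w with
      | nil => exact (hx.2 rfl).elim
      | @cons _ y _ hxy p =>
        refine ⟨y, fun h => (hx.2 h).elim, fun _ _ => ⟨hxy, h.1 y x hxy.symm, ?_⟩⟩
        have := SimpleGraph.dist_le p
        simp at hw
        omega
    · exact ⟨r, fun _ => rfl, fun h1 h2 => (hx ⟨h1, h2⟩).elim⟩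
  choose par h1 h2 using this
  exact ⟨par, fun x => F.dist x r, h1 r rfl, h2⟩

end S5

namespace S5
open Finset

theorem count_aux {β : Type*} [DecidableEq β] {n : ℕ} (F : Fin n → SimpleGraph β)
    (hd : ∀ i j, i ≠ j → Disjoint (F i) (F j)) (B W : Finset β) (J : Finset (Fin n))
    (r : Fin n → β) (par : Fin n → β → β) (dep : Fin n → β → ℕ)
    (h : ∀ j ∈ J, ∀ x ∈ B, x ≠ r j → (F j).Adj x (par j x) ∧ par j x ∈ B ∪ W)
    (hdep : ∀ j ∈ J, ∀ x ∈ B, x ≠ r j → dep j (par j x) < dep j x) :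
    ∑ j ∈ J, (B.erase (r j)).card ≤ B.card.choose 2 + B.card * W.card := by
  rw [← Finset.card_sigma]
  have hle : (J.sigma (fun j => B.erase (r j))).card ≤
      (B.offDiag.image (fun p : β × β => s(p.1, p.2)) ∪
        (B ×ˢ W).image (fun p : β × β => s(p.1, p.2))).card := by
    apply Finset.card_le_card_of_injOn (fun p => s(p.2, par p.1 p.2))
    · rintro ⟨j, x⟩ hp
      simp only [Finset.coe_sigma, Set.mem_sigma_iff, Finset.mem_coe, Finset.mem_erase] at hp
      obtain ⟨hj, hxr, hx⟩ := hp
      obtain ⟨h1, h2⟩ := h j hj x hx hxr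
      rw [Finset.mem_coe, Finset.mem_union]
      rcases Finset.mem_union.1 h2 with h3 | h3
      · left
        exact Finset.mem_image.2 ⟨(x, par j x), by simp [hx, h3, h1.ne], rfl⟩
      · right
        exact Finset.mem_image.2 ⟨(x, par j x), by simp [hx, h3], rfl⟩
    · rintro ⟨j, x⟩ hp ⟨j', x'⟩ hp' heq
      simp only [Finset.coe_sigma, Set.mem_sigma_iff, Finset.mem_coe, Finset.mem_erase] at hp hp'
      obtain ⟨hj, hxr, hx⟩ := hp
      obtain ⟨hj', hxr', hx'⟩ := hp'
      have a1 := (h j hj x hx hxr).1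
      have a2 := (h j' hj' x' hx' hxr').1
      have d1 := hdep j hj x hx hxr
      have d2 := hdep j' hj' x' hx' hxr'
      have hjj : j = j' := by
        by_contra hne
        have a3 : (F j).Adj x' (par j' x') := by
          rw [← SimpleGraph.mem_edgeSet] at a1 ⊢
          exact (show s(x, par j x) = s(x', par j' x') from heq) ▸ a1
        exact adj_of_disjoint (hd j j' hne) a3 a2
      subst hjj
      simp only [Sym2.eq_iff] at heq
      rcases heq with ⟨h1, _⟩ | ⟨h1, h2⟩
      · rw [h1]
      · rw [h2] at d1
        rw [← h1] at d2
        omega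
  refine hle.trans ((Finset.card_union_le _ _).trans (Nat.add_le_add ?_ ?_))
  · exact (Sym2.card_image_offDiag B).le
  · exact Finset.card_image_le.trans (by rw [Finset.card_product])

theorem count {β : Type*} [Fintype β] [DecidableEq β] {n : ℕ} (F : Fin n → SimpleGraph β)
    (hd : ∀ i j, i ≠ j → Disjoint (F i) (F j)) (X : Fin n → Set β)
    (hsp : ∀ i, Spans (F i) (X i)) (B W : Finset β) (hB : 2 ≤ B.card)
    (hBX : ∀ i, (B : Set β) ⊆ X i) (J : Finset (Fin n))
    (hJ : ∀ j ∈ J, X j ⊆ (B ∪ W : Finset β)) : J.card ≤ B.card / 2 + W.card := by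
  classical
  set k := B.card with hk
  have hB0 : B.Nonempty := Finset.card_pos.1 (by omega)
  obtain ⟨b0, hb0⟩ := hB0
  have hroot : ∀ j, ∃ r ∈ X j, ¬ (X j ⊆ B) → r ∉ B := fun j => by
    by_cases hj : X j ⊆ B
    · exact ⟨b0, hBX j hb0, fun h => (h hj).elim⟩
    · obtain ⟨r, h1, h2⟩ := Set.not_subset.1 hj
      exact ⟨r, h1, fun _ => h2⟩
  choose r hrX hrB using hroot
  choose par dep hpr hpar using fun j => exists_par (hsp j) (hrX j)
  let I := J.filter (fun j => X j ⊆ B)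
  have c1 := count_aux F hd B W J r par dep
    (fun j hj x hx hxr => ⟨(hpar j x (hBX j hx) hxr).1,
      by simpa using hJ j hj (hpar j x (hBX j hx) hxr).2.1⟩)
    (fun j hj x hx hxr => (hpar j x (hBX j hx) hxr).2.2)
  have c2 := count_aux F hd B ∅ I r par dep
    (fun j hj x hx hxr => ⟨(hpar j x (hBX j hx) hxr).1,
      by simpa using (Finset.mem_filter.1 hj).2 (hpar j x (hBX j hx) hxr).2.1⟩)
    (fun j hj x hx hxr => (hpar j x (hBX j hx) hxr).2.2)
  have e2 : I.card * (k - 1) ≤ ∑ j ∈ I, (B.erase (r j)).card := by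
    rw [← smul_eq_mul]
    exact Finset.card_nsmul_le_sum _ _ _ (fun j _ => Finset.pred_card_le_card_erase)
  have e1 : J.card * k ≤ ∑ j ∈ J, (B.erase (r j)).card + I.card := by
    have : I.card = ∑ j ∈ J, if X j ⊆ B then 1 else 0 := by
      exact Finset.card_filter _ _
    rw [this, ← Finset.sum_add_distrib, ← smul_eq_mul]
    apply Finset.card_nsmul_le_sum
    intro j hj
    split_ifs with h
    · have := Finset.pred_card_le_card_erase (s := B) (a := r j)
      omega
    · rw [Finset.erase_eq_of_notMem (hrB j h)]
      omega
  rw [← hk] at c1 c2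
  have hch : k.choose 2 * 2 = k * (k - 1) := by
    rw [Nat.choose_two_right]
    exact Nat.div_mul_cancel (Nat.even_mul_pred_self k).two_dvd
  obtain ⟨k', hk'⟩ : ∃ k', k = k' + 2 := ⟨k - 2, by omega⟩
  rw [hk'] at c1 c2 e1 e2 hch ⊢
  simp only [Nat.add_succ_sub_one, Finset.card_empty, mul_zero, add_zero] at *
  have f2 : 2 * I.card ≤ k' + 2 := by
    have : (2 * I.card) * (k' + 1) ≤ (k' + 2) * (k' + 1) := by nlinarith
    exact Nat.le_of_mul_le_mul_right this (by omega)
  have f1 : 2 * J.card ≤ (k' + 2) + 2 * W.card := by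
    have : (2 * J.card) * (k' + 2) ≤ ((k' + 2) + 2 * W.card) * (k' + 2) := by nlinarith
    exact Nat.le_of_mul_le_mul_right this (by omega)
  omega

/-- A packing: `m + n` disjoint graphs connecting `A`, the last `n` with distinct outer vertices. -/
structure Pack {V : Type*} (G : SimpleGraph V) (A : Finset V) (m n : ℕ) where
  T : Fin m ⊕ Fin n → SimpleGraph V
  X : Fin m ⊕ Fin n → Set V
  le : ∀ t, T t ≤ G
  disj : ∀ s t, s ≠ t → Disjoint (T s) (T t)
  spans : ∀ t, Spans (T t) (X t)
  sub : ∀ t, (A : Set V) ⊆ X t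
  d : Fin n → V
  inj : Function.Injective d
  notMem : ∀ i, d i ∉ A
  mem : ∀ i, d i ∈ X (Sum.inr i)

theorem exists_pack {V : Type*} [Fintype V] {G : SimpleGraph V} {k a : ℕ} (hk : 2 ≤ k)
    {A : Finset V} (hA : A.card = k) (h : HasEDSteinerTrees G (A : Set V) a) (ha : k / 2 ≤ a) :
    Nonempty (Pack G A (k / 2) (a - k / 2)) := by
  classical
  obtain ⟨F, X, hle, hX, hsp, hd⟩ := extract h
  let t : Fin a → Finset (V ⊕ Fin (k / 2)) := fun j =>
    ((X j).toFinset \ A).disjSum Finset.univ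
  have hall : ∀ s : Finset (Fin a), s.card ≤ (s.biUnion t).card := fun s => by
    rcases s.eq_empty_or_nonempty with rfl | ⟨j0, hj0⟩
    · simp
    have : (s.biUnion (fun j => (X j).toFinset \ A)).disjSum Finset.univ ⊆ s.biUnion t := by
      intro v hv
      rcases v with v | v
      · simp only [Finset.inl_mem_disjSum, Finset.mem_biUnion] at hv
        obtain ⟨j, hj, hv⟩ := hv
        exact Finset.mem_biUnion.2 ⟨j, hj, by simpa [t] using hv⟩
      · exact Finset.mem_biUnion.2 ⟨j0, hj0, by simp [t]⟩
    refine le_trans ?_ (Finset.card_le_card this)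
    rw [Finset.card_disjSum, Finset.card_univ, Fintype.card_fin]
    have := count F hd X hsp A (s.biUnion (fun j => (X j).toFinset \ A)) (by omega) hX s
      (fun j hj x hx => by
        by_cases hxA : x ∈ A
        · simp [hxA]
        · simp only [Finset.coe_union, Set.mem_union, Finset.mem_coe]
          right
          exact Finset.mem_biUnion.2 ⟨j, hj, by simp [hx, hxA]⟩)
    omega
  obtain ⟨f, hf, hft⟩ := (Finset.all_card_le_biUnion_card_iff_exists_injective t).1 hall
  let D := Finset.univ.filter (fun j => (f j).isRight)
  have hD : D.card ≤ k / 2 := by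
    have : D.card ≤ (Finset.univ.image (Sum.inr : Fin (k / 2) → V ⊕ Fin (k / 2))).card := by
      apply Finset.card_le_card_of_injOn f _ hf.injOn
      intro j hj
      have : (f j).isRight := by simpa [D] using hj
      obtain ⟨y, hy⟩ := Sum.isRight_iff.1 this
      simp [hy]
    simpa [Finset.card_image_of_injective _ Sum.inr_injective] using this
  obtain ⟨D', hDD', hD'⟩ := Finset.exists_superset_card_eq hD (by simpa using ha)
  have hcomp : (D'ᶜ).card = a - k / 2 := by rw [Finset.card_compl, hD', Fintype.card_fin]
  let e1 := D'.equivFinOfCardEq hD'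
  let e2 := D'ᶜ.equivFinOfCardEq hcomp
  let ix : Fin (k / 2) ⊕ Fin (a - k / 2) → Fin a :=
    Sum.elim (fun i => (e1.symm i : Fin a)) (fun i => (e2.symm i : Fin a))
  have hix : Function.Injective ix := by
    rintro (i | i) (j | j) hij <;> simp only [ix, Sum.elim_inl, Sum.elim_inr] at hij
    · rw [e1.symm.injective (Subtype.ext hij)]
    · have h1 := (e1.symm i).2
      have h2 := (e2.symm j).2
      rw [Finset.mem_compl] at h2
      exact (h2 (hij ▸ h1)).elim
    · have h1 := (e1.symm j).2
      have h2 := (e2.symm i).2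
      rw [Finset.mem_compl] at h2
      exact (h2 (hij ▸ h1)).elim
    · rw [e2.symm.injective (Subtype.ext hij)]
  have hl : ∀ i : Fin (a - k / 2), ∃ v, f (ix (Sum.inr i)) = Sum.inl v := fun i => by
    have h2 := (e2.symm i).2
    rw [Finset.mem_compl] at h2
    have h3 : (ix (Sum.inr i)) ∉ D := fun h => h2 (hDD' h)
    have h4 : (f (ix (Sum.inr i))).isLeft := by simpa [D] using h3
    exact Sum.isLeft_iff.1 h4
  choose d hdd using hl
  have hdt : ∀ i, d i ∈ (X (ix (Sum.inr i))).toFinset \ A := fun i => by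
    have := hft (ix (Sum.inr i))
    rw [hdd i] at this
    simpa only [t, Finset.inl_mem_disjSum] using this
  exact ⟨{
    T := fun t => F (ix t)
    X := fun t => X (ix t)
    le := fun t => hle _
    disj := fun s t hst => hd _ _ (fun h => hst (hix h))
    spans := fun t => hsp _
    sub := fun t => hX _
    d := d
    inj := fun i j hij => by
      have : f (ix (Sum.inr i)) = f (ix (Sum.inr j)) := by rw [hdd, hdd, hij]
      exact Sum.inr_injective (hix (hf this))
    notMem := fun i => (Finset.mem_sdiff.1 (hdt i)).2
    mem := fun i => by simpa using (Finset.mem_sdiff.1 (hdt i)).1 }⟩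

theorem Pack.conn {V : Type*} {G : SimpleGraph V} {A : Finset V} {m n : ℕ} (P : Pack G A m n)
    (t : Fin m ⊕ Fin n) {x y : V} (hx : x ∈ A) (hy : y ∈ A) : (P.T t).Reachable x y :=
  (P.spans t).2 _ (P.sub t hx) _ (P.sub t hy)

/-- `r` root, `s` branching vertex -/
def Good {β : Type*} (U : SimpleGraph β) (Q : Set β) (r s : β) : Prop :=
  ∃ P : β → SimpleGraph β, (∀ h ∈ Q, P h ≤ U ∧ (P h).Reachable h r ∧ (P h).Reachable h s) ∧
    ∀ h ∈ Q, ∃ h2 ∈ Q, (U \ P h2).Reachable h s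

theorem Good.self {β : Type*} {U : SimpleGraph β} {Q : Set β} {r s : β} (h : Good U Q r s) :
    Good U Q s s := by
  obtain ⟨P, h1, h2⟩ := h
  exact ⟨P, fun h hh => ⟨(h1 h hh).1, (h1 h hh).2.2, (h1 h hh).2.2⟩, h2⟩

theorem good_singleton {β : Type*} {U : SimpleGraph β} {h r : β} (hr : U.Reachable h r) :
    Good U {h} r h := by
  refine ⟨fun _ => U, ?_, ?_⟩
  · rintro _ rfl
    exact ⟨le_rfl, hr, SimpleGraph.Reachable.refl _⟩
  · rintro _ rfl
    exact ⟨_, rfl, SimpleGraph.Reachable.refl _⟩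

theorem exists_good {β : Type*} [Fintype β] {U : SimpleGraph β} {X : Set β} (hU : Spans U X)
    {Q : Set β} (hQ : Q ⊆ X) {r : β} (hr : r ∈ X) : ∃ s, Good U Q r s := by
  classical
  obtain ⟨par, dep, hpr, hpar⟩ := exists_par hU hr
  have hit : ∀ n, ∀ x ∈ X, par^[n] x ∈ X := by
    intro n
    induction n with
    | zero => intro x hx; exact hx
    | succ n ih =>
      intro x hx
      rw [Function.iterate_succ_apply]
      by_cases hxr : x = r
      · subst hxr; rw [hpr]; exact ih _ hx
      · exact ih _ (hpar x hx hxr).2.1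
  have hroot : ∀ d, ∀ x ∈ X, dep x ≤ d → ∃ n, par^[n] x = r := by
    intro d
    induction d with
    | zero =>
      intro x hx hd
      by_cases hxr : x = r
      · exact ⟨0, hxr⟩
      · have := (hpar x hx hxr).2.2
        omega
    | succ d ih =>
      intro x hx hd
      by_cases hxr : x = r
      · exact ⟨0, hxr⟩
      · obtain ⟨_, h1, h2⟩ := hpar x hx hxr
        obtain ⟨n, hn⟩ := ih _ h1 (by omega)
        exact ⟨n + 1, by rw [Function.iterate_succ_apply, hn]⟩
  let Anc : β → β → Prop := fun y x => ∃ n, par^[n] x = y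
  let C : Finset β := Finset.univ.filter (fun s => ∀ h ∈ Q, Anc s h)
  have hC : C.Nonempty := ⟨r, by
    simp only [C, Finset.mem_filter, Finset.mem_univ, true_and]
    exact fun h hh => hroot _ h (hQ hh) le_rfl⟩
  obtain ⟨s, hs, hmax⟩ := Finset.exists_max_image C dep hC
  simp only [C, Finset.mem_filter, Finset.mem_univ, true_and] at hs hmax
  let P : β → SimpleGraph β := fun h =>
    SimpleGraph.fromRel (fun x y => Anc x h ∧ x ≠ r ∧ y = par x)
  have hPreach : ∀ h ∈ X, ∀ n, (P h).Reachable h (par^[n] h) := by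
    intro h hh n
    induction n with
    | zero => exact SimpleGraph.Reachable.refl _
    | succ n ih =>
      rw [Function.iterate_succ_apply']
      by_cases hxr : par^[n] h = r
      · rw [hxr, hpr, ← hxr]; exact ih
      · refine ih.trans (SimpleGraph.Adj.reachable ?_)
        rw [SimpleGraph.fromRel_adj]
        exact ⟨(hpar _ (hit n h hh) hxr).1.ne, Or.inl ⟨⟨n, rfl⟩, hxr, rfl⟩⟩
  have hPle : ∀ h ∈ X, P h ≤ U := by
    intro h hh x y hxy
    rw [SimpleGraph.fromRel_adj] at hxy
    obtain ⟨_, ⟨⟨n, hn⟩, hxr, rfl⟩ | ⟨⟨n, hn⟩, hxr, rfl⟩⟩ := hxy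
    · exact (hpar x (hn ▸ hit n h hh) hxr).1
    · exact (hpar y (hn ▸ hit n h hh) hxr).1.symm
  refine ⟨s, P, fun h hh => ⟨hPle h (hQ hh), ?_, ?_⟩, fun h hh => ?_⟩
  · obtain ⟨n, hn⟩ := hroot _ h (hQ hh) le_rfl
    exact hn ▸ hPreach h (hQ hh) n
  · obtain ⟨n, hn⟩ := hs h hh
    exact hn ▸ hPreach h (hQ hh) n
  · by_cases hhs : h = s
    · subst hhs
      exact ⟨h, hh, SimpleGraph.Reachable.refl _⟩
    have hex := hs h hh
    let n := Nat.find hex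
    have hn : par^[n] h = s := Nat.find_spec hex
    have hmin : ∀ i < n, par^[i] h ≠ s := fun i hi => Nat.find_min hex hi
    have hn0 : n ≠ 0 := fun h0 => hhs (by simpa [h0] using hn)
    obtain ⟨l, hl⟩ := Nat.exists_eq_succ_of_ne_zero hn0
    let s' := par^[l] h
    have hs's : par s' = s := by
      rw [← hn, hl, Function.iterate_succ_apply']
    have hlt : ∀ i < n, par^[i] h ≠ r := by
      intro i hi hir
      have hst : ∀ j, par^[j] r = r := fun j => by
        induction j with
        | zero => rfl
        | succ j ih => rw [Function.iterate_succ_apply, hpr, ih]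
      have : par^[n] h = r := by
        have : n = (n - i) + i := by omega
        rw [this, Function.iterate_add_apply, hir, hst]
      exact hmin i hi (by rw [hir, ← this, hn])
    have hs'X : s' ∈ X := hit l h (hQ hh)
    have hdep : dep s < dep s' := by
      rw [← hs's]
      exact (hpar s' hs'X (hlt l (by omega))).2.2
    have : ∃ h2 ∈ Q, ¬ Anc s' h2 := by
      by_contra hcon
      push Not at hcon
      have := hmax s' hcon
      omega
    obtain ⟨h2, hh2, hna⟩ := this
    refine ⟨h2, hh2, ?_⟩
    have hr2 : ∀ i ≤ n, (U \ P h2).Reachable h (par^[i] h) := by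
      intro i
      induction i with
      | zero => intro _; exact SimpleGraph.Reachable.refl _
      | succ i ih =>
        intro hi
        refine (ih (by omega)).trans (SimpleGraph.Adj.reachable ?_)
        rw [Function.iterate_succ_apply']
        have hx := hpar _ (hit i h (hQ hh)) (hlt i (by omega))
        refine (SimpleGraph.sdiff_adj _ _ _ _).2 ⟨hx.1, fun hP => ?_⟩
        rw [SimpleGraph.fromRel_adj] at hP
        obtain ⟨_, ⟨⟨j, hj⟩, _, _⟩ | ⟨_, hne, heq⟩⟩ := hP
        · apply hna
          refine ⟨(l - i) + j, ?_⟩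
          rw [Function.iterate_add_apply, hj, ← Function.iterate_add_apply]
          congr 2
          omega
        · have h3 := hpar _ hx.2.1 hne
          rw [← heq] at h3
          omega
    exact hn ▸ hr2 n le_rfl

end S5

namespace S5

/-- union of the graphs `T t` with `t` in use -/
def useG {V τ : Type*} (T : τ → SimpleGraph V) (u : τ → Prop) : SimpleGraph V where
  Adj x y := ∃ t, u t ∧ (T t).Adj x y
  symm := ⟨fun _ _ ⟨t, h, h'⟩ => ⟨t, h, h'.symm⟩⟩
  loopless := ⟨fun _ ⟨_, _, h⟩ => h.ne rfl⟩

theorem le_useG {V τ : Type*} (T : τ → SimpleGraph V) {u : τ → Prop} {t : τ} (h : u t) :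
    T t ≤ useG T u := fun _ _ hxy => ⟨t, h, hxy⟩

/-- rows `R`, columns `C` -/
def prodG {α β : Type*} (R : β → SimpleGraph α) (C : α → SimpleGraph β) :
    SimpleGraph (α × β) where
  Adj p q := (p.2 = q.2 ∧ (R p.2).Adj p.1 q.1) ∨ (p.1 = q.1 ∧ (C p.1).Adj p.2 q.2)
  symm := ⟨fun p q h => by
    rcases h with ⟨h, h'⟩ | ⟨h, h'⟩
    · exact Or.inl ⟨h.symm, h ▸ h'.symm⟩
    · exact Or.inr ⟨h.symm, h ▸ h'.symm⟩⟩
  loopless := ⟨fun p h => by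
    rcases h with ⟨_, h'⟩ | ⟨_, h'⟩
    · exact h'.ne rfl
    · exact h'.ne rfl⟩

theorem prodG_row {α β : Type*} {R : β → SimpleGraph α} {C : α → SimpleGraph β} {h : β} {x y : α}
    (hr : (R h).Reachable x y) : (prodG R C).Reachable (x, h) (y, h) := by
  let f : R h →g prodG R C := ⟨fun x => (x, h), fun {a b} hab => Or.inl ⟨rfl, hab⟩⟩
  exact hr.map f

theorem prodG_col {α β : Type*} {R : β → SimpleGraph α} {C : α → SimpleGraph β} {g : α} {x y : β}
    (hr : (C g).Reachable x y) : (prodG R C).Reachable (g, x) (g, y) := by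
  let f : C g →g prodG R C := ⟨fun x => (g, x), fun {a b} hab => Or.inr ⟨rfl, hab⟩⟩
  exact hr.map f

theorem assemble {α β ι τ σ : Type*} [Fintype ι] {G : SimpleGraph α} {H : SimpleGraph β}
    {S : Set (α × β)} {n : ℕ} (hn : Fintype.card ι = n)
    (TR : β → τ → SimpleGraph α) (TC : α → σ → SimpleGraph β)
    (hR : ∀ h t, TR h t ≤ G) (hC : ∀ g t, TC g t ≤ H)
    (dR : ∀ h s t, s ≠ t → Disjoint (TR h s) (TR h t))
    (dC : ∀ g s t, s ≠ t → Disjoint (TC g s) (TC g t))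
    (uR : ι → β → τ → Prop) (uC : ι → α → σ → Prop)
    (hu : ∀ u v h t, uR u h t → uR v h t → u = v)
    (hv : ∀ u v g t, uC u g t → uC v g t → u = v)
    (z : ι → α × β)
    (hr : ∀ u (F : SimpleGraph (α × β)),
      (∀ h t x y, uR u h t → (TR h t).Reachable x y → F.Reachable (x, h) (y, h)) →
      (∀ g t x y, uC u g t → (TC g t).Reachable x y → F.Reachable (g, x) (g, y)) →
      ∀ x y, (x, y) ∈ S → F.Reachable (x, y) (z u)) : HasF (G □ H) S n := by
  refine HasF.of_fintype hn
    (fun u => prodG (fun h => useG (TR h) (uR u h)) (fun g => useG (TC g) (uC u g))) ?_ ?_ ?_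
  · rintro u ⟨a, b⟩ ⟨c, d⟩ (⟨h, t, _, h'⟩ | ⟨h, t, _, h'⟩)
    · exact SimpleGraph.boxProd_adj.2 (Or.inl ⟨hR _ _ h', h⟩)
    · exact SimpleGraph.boxProd_adj.2 (Or.inr ⟨hC _ _ h', h⟩)
  · intro u v huv
    apply disjoint_of_adj
    rintro ⟨a, b⟩ ⟨c, d⟩ (⟨h, t, h1, h'⟩ | ⟨h, t, h1, h'⟩) (⟨k, s, k1, k'⟩ | ⟨k, s, k1, k'⟩)
    · by_cases hst : s = t
      · subst hst
        exact huv (hu _ _ _ _ h1 k1)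
      · exact adj_of_disjoint (dR _ _ _ hst) k' h'
    · exact h'.ne k
    · exact k'.ne h
    · by_cases hst : s = t
      · subst hst
        exact huv (hv _ _ _ _ h1 k1)
      · exact adj_of_disjoint (dC _ _ _ hst) k' h'
  · intro u
    have key := hr u _ (fun h t x y ht hxy => prodG_row (R := fun h => useG (TR h) (uR u h))
        (C := fun g => useG (TC g) (uC u g)) (hxy.mono (le_useG (TR h) ht)))
      (fun g t x y ht hxy => prodG_col (R := fun h => useG (TR h) (uR u h))
        (C := fun g => useG (TC g) (uC u g)) (hxy.mono (le_useG (TC g) ht)))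
    rintro ⟨x, y⟩ hx ⟨x', y'⟩ hx'
    exact (key _ _ hx).trans (key _ _ hx').symm

theorem Pack.conn_d {V : Type*} {G : SimpleGraph V} {A : Finset V} {m n : ℕ} (P : Pack G A m n)
    (i : Fin n) {x : V} (hx : x ∈ A) : (P.T (Sum.inr i)).Reachable x (P.d i) :=
  (P.spans _).2 _ (P.sub _ hx) _ (P.mem i)

theorem caseI {α β : Type*} {G : SimpleGraph α} {H : SimpleGraph β} {A : Finset α} {B : Finset β}
    {m a b : ℕ} (hm : 0 < m) (P : Pack G A m a) (Q : Pack H B m b) {S : Set (α × β)}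
    (hSA : ∀ x y, (x, y) ∈ S → x ∈ A) (hSB : ∀ x y, (x, y) ∈ S → y ∈ B)
    (g0 : α) (h0 : β) (hg0 : g0 ∈ A) (hh0 : h0 ∈ B)
    (h1 : ∀ y, (g0, y) ∈ S → y = h0) (h2 : ∀ x, (x, h0) ∈ S → x = g0) :
    HasF (G □ H) S ((m + m) + (a + b)) := by
  refine assemble (ι := (Fin m ⊕ Fin m) ⊕ (Fin a ⊕ Fin b)) (by simp)
    (fun _ => P.T) (fun _ => Q.T) (fun _ => P.le) (fun _ => Q.le) (fun _ => P.disj)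
    (fun _ => Q.disj)
    (fun u h t => match u with
      | Sum.inl (Sum.inl i) => h ∈ B ∧ h ≠ h0 ∧ t = Sum.inl i
      | Sum.inl (Sum.inr i) => h = h0 ∧ t = Sum.inl i
      | Sum.inr (Sum.inl i) => h ∈ B ∧ t = Sum.inr i
      | Sum.inr (Sum.inr j) => h = Q.d j ∧ t = Sum.inl ⟨0, hm⟩)
    (fun u g t => match u with
      | Sum.inl (Sum.inl i) => g = g0 ∧ t = Sum.inl i
      | Sum.inl (Sum.inr i) => g ∈ A ∧ g ≠ g0 ∧ t = Sum.inl i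
      | Sum.inr (Sum.inl i) => g = P.d i ∧ t = Sum.inl ⟨0, hm⟩
      | Sum.inr (Sum.inr j) => g ∈ A ∧ t = Sum.inr j) ?_ ?_
    (fun u => match u with
      | Sum.inl _ => (g0, h0)
      | Sum.inr (Sum.inl i) => (P.d i, h0)
      | Sum.inr (Sum.inr j) => (g0, Q.d j)) ?_
  · have hn := Q.notMem
    have hi := fun i j => @Q.inj i j
    rintro ((i | i) | (i | i)) ((j | j) | (j | j)) h t <;> simp only <;> grind
  · have hn := P.notMem
    have hi := fun i j => @P.inj i j
    rintro ((i | i) | (i | i)) ((j | j) | (j | j)) h t <;> simp only <;> grind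
  · rintro ((i | i) | (i | i)) F hr hc x y hxy
    · have hx := hSA _ _ hxy
      have hy := hSB _ _ hxy
      by_cases hyh : y = h0
      · subst hyh
        rw [h2 _ hxy]
      · exact (hr y (Sum.inl i) x g0 ⟨hy, hyh, rfl⟩ (P.conn _ hx hg0)).trans
          (hc g0 (Sum.inl i) y h0 ⟨rfl, rfl⟩ (Q.conn _ hy hh0))
    · have hx := hSA _ _ hxy
      have hy := hSB _ _ hxy
      by_cases hxg : x = g0
      · subst hxg
        rw [h1 _ hxy]
      · exact (hc x (Sum.inl i) y h0 ⟨hx, hxg, rfl⟩ (Q.conn _ hy hh0)).trans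
          (hr h0 (Sum.inl i) x g0 ⟨rfl, rfl⟩ (P.conn _ hx hg0))
    · have hx := hSA _ _ hxy
      have hy := hSB _ _ hxy
      exact (hr y (Sum.inr i) x (P.d i) ⟨hy, rfl⟩ (P.conn_d _ hx)).trans
          (hc (P.d i) _ y h0 ⟨rfl, rfl⟩ (Q.conn _ hy hh0))
    · have hx := hSA _ _ hxy
      have hy := hSB _ _ hxy
      exact (hc x (Sum.inr i) y (Q.d i) ⟨hx, rfl⟩ (Q.conn_d _ hy)).trans
          (hr (Q.d i) _ x g0 ⟨rfl, rfl⟩ (P.conn _ hx hg0))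

theorem labels {W β : Type*} [Fintype W] [DecidableEq β] {m : ℕ} (hm : 0 < m) (pos : W → β)
    (Q : Finset β)
    (h : ∀ y, y ∉ Q → (Finset.univ.filter (fun w => pos w = y)).card ≤ m) :
    ∃ l : W → Fin m, ∀ w w', pos w = pos w' → pos w ∉ Q → l w = l w' → w = w' := by
  classical
  have : ∀ y, ∃ f : W → Fin m, y ∉ Q → ∀ w w', pos w = y → pos w' = y → f w = f w' → w = w' := by
    intro y
    by_cases hy : y ∈ Q
    · exact ⟨fun _ => ⟨0, hm⟩, fun h => (h hy).elim⟩
    · let D := Finset.univ.filter (fun w => pos w = y)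
      let e : D ≃ Fin D.card := D.equivFin
      refine ⟨fun w => if hw : w ∈ D then Fin.castLE (h y hy) (e ⟨w, hw⟩) else ⟨0, hm⟩,
        fun _ w w' hw hw' heq => ?_⟩
      have hw1 : w ∈ D := by simp [D, hw]
      have hw2 : w' ∈ D := by simp [D, hw']
      simp only [hw1, hw2, dif_pos] at heq
      have := e.injective (Fin.castLE_injective (h y hy) heq)
      simpa using this
  choose f hf using this
  refine ⟨fun w => f (pos w) w, fun w w' hp hq heq => hf (pos w) hq w w' rfl hp.symm ?_⟩
  simpa [hp] using heq

theorem caseII {α β : Type*} [DecidableEq β] {G : SimpleGraph α} {H : SimpleGraph β}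
    {A : Finset α} {B : Finset β}
    {m a b : ℕ} (hm : 0 < m) (P : Pack G A m a) (Q : Pack H B m b) {S : Set (α × β)}
    (D : Finset β) (hDB : D ⊆ B)
    (hSA : ∀ x y, (x, y) ∈ S → x ∈ A) (hSD : ∀ x y, (x, y) ∈ S → y ∈ D)
    (hsurj : ∀ y ∈ D, ∃ x, (x, y) ∈ S) (hf : α → β) (hhf : ∀ x y, (x, y) ∈ S → hf x = y)
    (g0 : α) (hg0 : g0 ∈ A) (h0 : β) (hh0 : h0 ∈ D)
    (r s : Fin m → β) (c : Fin b → β) (hrD : ∀ i, r i ∉ D) (hcD : ∀ j, c j ∉ D)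
    (hcX : ∀ j, c j ∈ Q.X (Sum.inr j))
    (hgood : ∀ i, Good (Q.T (Sum.inl i)) D (r i) (s i))
    (hload : ∀ y, y ∉ D → (Finset.univ.filter (fun i => r i = y)).card +
      (Finset.univ.filter (fun i => s i = y)).card +
      (Finset.univ.filter (fun i => c i = y)).card ≤ m) :
    HasF (G □ H) S ((m + m) + (a + b)) := by
  classical
  obtain ⟨l, hl⟩ := labels (W := (Fin m ⊕ Fin m) ⊕ Fin b) hm
    (Sum.elim (Sum.elim r s) c) D (fun y hy => by
      refine le_trans (le_of_eq ?_) (hload y hy)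
      simp only [Finset.card_filter, Fintype.sum_sum_type, Sum.elim_inl, Sum.elim_inr]
      congr!)
  choose p hp1 hp2 using hgood
  let p' : Fin m → α → SimpleGraph β := fun i g => if g ∈ A then p i (hf g) else ⊥
  have hp' : ∀ i g, g ∈ A → p' i g = p i (hf g) := fun i g hg => by simp [p', hg]
  have hp'' : ∀ i g, g ∉ A → p' i g = ⊥ := fun i g hg => by simp [p', hg]
  refine assemble (ι := (Fin m ⊕ Fin m) ⊕ (Fin a ⊕ Fin b)) (σ := (Fin m ⊕ Fin m) ⊕ Fin b)
    (by simp)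
    (fun _ => P.T) (fun g t => match t with
      | Sum.inl (Sum.inl i) => Q.T (Sum.inl i) \ p' i g
      | Sum.inl (Sum.inr i) => p' i g ⊓ Q.T (Sum.inl i)
      | Sum.inr j => Q.T (Sum.inr j)) (fun _ => P.le) ?_ (fun _ => P.disj) ?_
    (fun u h t => match u with
      | Sum.inl (Sum.inl i) => (h ∈ D ∧ t = Sum.inl i) ∨
          (h = s i ∧ h ∉ D ∧ t = Sum.inl (l (Sum.inl (Sum.inr i))))
      | Sum.inl (Sum.inr i) => h = r i ∧ t = Sum.inl (l (Sum.inl (Sum.inl i)))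
      | Sum.inr (Sum.inl i) => h ∈ D ∧ t = Sum.inr i
      | Sum.inr (Sum.inr j) => h = c j ∧ t = Sum.inl (l (Sum.inr j)))
    (fun u g t => match u with
      | Sum.inl (Sum.inl i) => g ∈ A ∧ t = Sum.inl (Sum.inl i)
      | Sum.inl (Sum.inr i) => g ∈ A ∧ t = Sum.inl (Sum.inr i)
      | Sum.inr (Sum.inl i) => g = P.d i ∧ t = Sum.inl (Sum.inl ⟨0, hm⟩)
      | Sum.inr (Sum.inr j) => g ∈ A ∧ t = Sum.inr j) ?_ ?_
    (fun u => match u with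
      | Sum.inl (Sum.inl i) => (g0, s i)
      | Sum.inl (Sum.inr i) => (g0, r i)
      | Sum.inr (Sum.inl i) => (P.d i, h0)
      | Sum.inr (Sum.inr j) => (g0, c j)) ?_
  · rintro g ((i | i) | i)
    · exact sdiff_le.trans (Q.le _)
    · exact inf_le_right.trans (Q.le _)
    · exact Q.le _
  · rintro g ((i | i) | i) ((j | j) | j) hij
    · exact (Q.disj _ _ (by simpa using hij)).mono sdiff_le sdiff_le
    · by_cases h : i = j
      · subst h
        exact disjoint_sdiff_self_left.mono_right inf_le_left
      · exact (Q.disj _ _ (by simpa using h)).mono sdiff_le inf_le_right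
    · exact (Q.disj _ _ (by simp)).mono_left sdiff_le
    · by_cases h : i = j
      · subst h
        exact disjoint_sdiff_self_right.mono_left inf_le_left
      · exact (Q.disj _ _ (by simpa using h)).mono inf_le_right sdiff_le
    · exact (Q.disj _ _ (by simpa using hij)).mono inf_le_right inf_le_right
    · exact (Q.disj _ _ (by simp)).mono_left inf_le_right
    · exact (Q.disj _ _ (by simp)).mono_right sdiff_le
    · exact (Q.disj _ _ (by simp)).mono_right inf_le_right
    · exact Q.disj _ _ (by simpa using hij)
  · have l1 : ∀ i j, r i = r j → l (Sum.inl (Sum.inl i)) = l (Sum.inl (Sum.inl j)) → i = j :=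
      fun i j h h' => by simpa using hl (Sum.inl (Sum.inl i)) (Sum.inl (Sum.inl j)) h (hrD i) h'
    have l2 : ∀ i j, s i = s j → s i ∉ D → l (Sum.inl (Sum.inr i)) = l (Sum.inl (Sum.inr j)) →
        i = j :=
      fun i j h hd h' => by simpa using hl (Sum.inl (Sum.inr i)) (Sum.inl (Sum.inr j)) h hd h'
    have l3 : ∀ i j, c i = c j → l (Sum.inr i) = l (Sum.inr j) → i = j :=
      fun i j h h' => by simpa using hl (Sum.inr i) (Sum.inr j) h (hcD i) h'
    have l4 : ∀ i j, r i = s j → l (Sum.inl (Sum.inl i)) = l (Sum.inl (Sum.inr j)) → False :=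
      fun i j h h' => by simpa using hl (Sum.inl (Sum.inl i)) (Sum.inl (Sum.inr j)) h (hrD i) h'
    have l5 : ∀ i j, r i = c j → l (Sum.inl (Sum.inl i)) = l (Sum.inr j) → False :=
      fun i j h h' => by simpa using hl (Sum.inl (Sum.inl i)) (Sum.inr j) h (hrD i) h'
    have l6 : ∀ i j, c i = s j → l (Sum.inr i) = l (Sum.inl (Sum.inr j)) → False :=
      fun i j h h' => by simpa using hl (Sum.inr i) (Sum.inl (Sum.inr j)) h (hcD i) h'
    clear hl hload hp1 hp2
    rintro ((i | i) | (i | i)) ((j | j) | (j | j)) h t <;> simp only <;> grind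
  · have hn := P.notMem
    have hi := fun i j => @P.inj i j
    clear hl hload hp1 hp2
    rintro ((i | i) | (i | i)) ((j | j) | (j | j)) h t <;> simp only <;> grind
  · rintro ((i | i) | (i | i)) F hr hc x y hxy
    · have hx := hSA _ _ hxy
      have hy := hSD _ _ hxy
      obtain ⟨y2, hy2, hre⟩ := hp2 i y hy
      obtain ⟨x2, hx2⟩ := hsurj y2 hy2
      have hx2A := hSA _ _ hx2
      refine (hr y (Sum.inl i) x x2 (Or.inl ⟨hy, rfl⟩) (P.conn _ hx hx2A)).trans ?_
      refine (hc x2 (Sum.inl (Sum.inl i)) y (s i) ⟨hx2A, rfl⟩ ?_).trans ?_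
      · simpa only [hp' i x2 hx2A, hhf _ _ hx2] using hre
      · by_cases hs : s i ∈ D
        · exact hr (s i) (Sum.inl i) x2 g0 (Or.inl ⟨hs, rfl⟩) (P.conn _ hx2A hg0)
        · exact hr (s i) _ x2 g0 (Or.inr ⟨rfl, hs, rfl⟩) (P.conn _ hx2A hg0)
    · have hx := hSA _ _ hxy
      have hy := hSD _ _ hxy
      refine (hc x (Sum.inl (Sum.inr i)) y (r i) ⟨hx, rfl⟩ ?_).trans
        (hr (r i) _ x g0 ⟨rfl, rfl⟩ (P.conn _ hx hg0))
      have := hp1 i y hy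
      simp only [hp' i x hx, hhf _ _ hxy]
      rw [inf_eq_left.2 this.1]
      exact this.2.1
    · have hx := hSA _ _ hxy
      have hy := hSD _ _ hxy
      refine (hr y (Sum.inr i) x (P.d i) ⟨hy, rfl⟩ (P.conn_d _ hx)).trans
          (hc (P.d i) (Sum.inl (Sum.inl ⟨0, hm⟩)) y h0 ⟨rfl, rfl⟩ ?_)
      simp only [hp'' _ _ (P.notMem i), sdiff_bot]
      exact Q.conn _ (hDB hy) (hDB hh0)
    · have hx := hSA _ _ hxy
      have hy := hSD _ _ hxy
      exact (hc x (Sum.inr i) y (c i) ⟨hx, rfl⟩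
        ((Q.spans _).2 _ (Q.sub _ (hDB hy)) _ (hcX i))).trans
          (hr (c i) _ x g0 ⟨rfl, rfl⟩ (P.conn _ hx hg0))

end S5

namespace S5

theorem fiber_le_one {β : Type*} [DecidableEq β] {n : ℕ} {f : Fin n → β}
    (hf : Function.Injective f) (y : β) : (Finset.univ.filter (fun i => f i = y)).card ≤ 1 := by
  refine Finset.card_le_one.2 fun i hi j hj => hf ?_
  simp only [Finset.mem_filter, Finset.mem_univ, true_and] at hi hj
  rw [hi, hj]

theorem fiber_zero {β : Type*} [DecidableEq β] {n : ℕ} {f : Fin n → β} {y : β}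
    (hf : ∀ i, f i ≠ y) : (Finset.univ.filter (fun i => f i = y)).card = 0 := by
  rw [Finset.card_eq_zero, Finset.filter_eq_empty_iff]
  exact fun i _ => hf i

theorem fiber_le {β : Type*} [DecidableEq β] {n : ℕ} (f : Fin n → β) (y : β) :
    (Finset.univ.filter (fun i => f i = y)).card ≤ n :=
  (Finset.card_le_univ _).trans (by simp)

theorem load_alpha {β : Type*} [DecidableEq β] {m n : ℕ} {B : Finset β} {r s : Fin m → β}
    {c : Fin n → β} (hr : Function.Injective r) (hrB : ∀ i, r i ∈ B) (hc : Function.Injective c)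
    (hcB : ∀ j, c j ∉ B) {i1 i2 : Fin m} (hs : s i1 ≠ s i2) (y : β) :
    (Finset.univ.filter (fun i => r i = y)).card +
      (Finset.univ.filter (fun i => s i = y)).card +
      (Finset.univ.filter (fun i => c i = y)).card ≤ m := by
  have h1 := fiber_le_one hr y
  have h2 := fiber_le_one hc y
  have h3 : (Finset.univ.filter (fun i => s i = y)).card < m := by
    have : (Finset.univ.filter (fun i => s i = y)).card < (Finset.univ : Finset (Fin m)).card := by
      apply Finset.card_lt_card
      rw [Finset.filter_ssubset]
      by_cases h : s i1 = y
      · exact ⟨i2, Finset.mem_univ _, fun h' => hs (h.trans h'.symm)⟩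
      · exact ⟨i1, Finset.mem_univ _, h⟩
    simpa using this
  by_cases hy : y ∈ B
  · have := fiber_zero (f := c) (y := y) (fun j h => hcB j (h ▸ hy))
    omega
  · have := fiber_zero (f := r) (y := y) (fun j h => hy (h ▸ hrB j))
    omega

theorem load_beta {β : Type*} [DecidableEq β] {m n : ℕ} (hm : 0 < m) {B : Finset β}
    {r s : Fin m → β}
    {c : Fin n → β} (hrB : ∀ i, r i ∈ B) (hc : Function.Injective c)
    (hcB : ∀ j, c j ∉ B) {y0 : β} (hs : ∀ i, s i = y0) (hy0 : y0 ∈ B) (hr0 : ∀ i, r i ≠ y0)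
    (y : β) :
    (Finset.univ.filter (fun i => r i = y)).card +
      (Finset.univ.filter (fun i => s i = y)).card +
      (Finset.univ.filter (fun i => c i = y)).card ≤ m := by
  have h1 := fiber_le r y
  have h2 := fiber_le_one hc y
  have h3 := fiber_le s y
  by_cases hyy : y = y0
  · subst hyy
    have := fiber_zero hr0
    have := fiber_zero (f := c) (y := y) (fun j h => hcB j (h ▸ hy0))
    omega
  · have := fiber_zero (f := s) (y := y) (fun j h => hyy (h ▸ hs j))
    by_cases hy : y ∈ B
    · have := fiber_zero (f := c) (y := y) (fun j h => hcB j (h ▸ hy))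
      omega
    · have := fiber_zero (f := r) (y := y) (fun j h => hy (h ▸ hrB j))
      omega

theorem exists_load {β : Type*} [Fintype β] [DecidableEq β] {H : SimpleGraph β} {B : Finset β}
    {m b : ℕ} (hm : 0 < m) (Q : Pack H B m b) (D : Finset β) (hDB : D ⊆ B) (hD : D.Nonempty)
    (hDm : D.card ≤ m) (hBD : m ≤ (B \ D).card) :
    ∃ (r s : Fin m → β) (c : Fin b → β), (∀ i, r i ∉ D) ∧ (∀ j, c j ∉ D) ∧
      (∀ j, c j ∈ Q.X (Sum.inr j)) ∧ (∀ i, Good (Q.T (Sum.inl i)) D (r i) (s i)) ∧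
      ∀ y, y ∉ D → (Finset.univ.filter (fun i => r i = y)).card +
      (Finset.univ.filter (fun i => s i = y)).card +
      (Finset.univ.filter (fun i => c i = y)).card ≤ m := by
  classical
  obtain ⟨R, hRs, hR⟩ := Finset.exists_subset_card_eq hBD
  let e := (R.equivFinOfCardEq hR).symm
  let r : Fin m → β := fun i => (e i).1
  have hri : Function.Injective r := Subtype.val_injective.comp e.injective
  have hrR : ∀ i, r i ∈ B \ D := fun i => hRs (e i).2
  have hrB : ∀ i, r i ∈ B := fun i => (Finset.mem_sdiff.1 (hrR i)).1
  have hrD : ∀ i, r i ∉ D := fun i => (Finset.mem_sdiff.1 (hrR i)).2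
  have hcD : ∀ j, Q.d j ∉ D := fun j h => Q.notMem j (hDB h)
  have hDX : ∀ t, (D : Set β) ⊆ Q.X t := fun t x hx => Q.sub t (hDB hx)
  by_cases hq : D.card = 1
  · obtain ⟨h, rfl⟩ := Finset.card_eq_one.1 hq
    have hhB : h ∈ B := hDB (by simp)
    refine ⟨r, fun _ => h, Q.d, hrD, hcD, Q.mem, fun i => ?_, fun y _ =>
      load_beta hm hrB Q.inj Q.notMem (y0 := h) (fun _ => rfl) hhB
        (fun i hi => hrD i (by simp [hi])) y⟩
    rw [Finset.coe_singleton]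
    exact good_singleton (Q.conn _ hhB (hrB i))
  have hm2 : 2 ≤ m := by
    have := hD.card_pos
    omega
  have hex : ∀ i j, ∃ z, Good (Q.T (Sum.inl i)) D (r j) z := fun i j =>
    exists_good (Q.spans _) (hDX _) (Q.sub _ (hrB j))
  choose s hs using fun i => hex i i
  by_cases hconst : ∃ i1 i2, s i1 ≠ s i2
  · obtain ⟨i1, i2, h12⟩ := hconst
    exact ⟨r, s, Q.d, hrD, hcD, Q.mem, hs, fun y _ => load_alpha hri hrB Q.inj Q.notMem h12 y⟩
  push Not at hconst
  let z0 : Fin m := ⟨0, hm⟩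
  obtain ⟨y0, hy0⟩ : ∃ y0, ∀ i, s i = y0 := ⟨s z0, fun i => hconst i z0⟩
  by_cases hyB : y0 ∈ B
  · by_cases hyr : ∃ i1, r i1 = y0
    · obtain ⟨i1, hi1⟩ := hyr
      obtain ⟨i2, hi2⟩ : ∃ i2 : Fin m, i2 ≠ i1 := by
        have : Nontrivial (Fin m) := Fin.nontrivial_iff_two_le.2 hm2
        exact exists_ne i1
      obtain ⟨z, hz⟩ := hex i1 i2
      by_cases hzy : z = y0
      · refine ⟨Function.update r i1 (r i2), s, Q.d, fun i => ?_, hcD, Q.mem, fun i => ?_,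
          fun y _ => load_beta hm (B := B) (fun i => ?_) Q.inj Q.notMem hy0 hyB (fun i => ?_) y⟩
        · by_cases h : i = i1 <;> simp [Function.update_apply, h, hrD]
        · by_cases h : i = i1
          · subst h
            rw [Function.update_self, hy0, ← hzy]
            exact hz
          · rw [Function.update_of_ne h]
            exact hs i
        · by_cases h : i = i1 <;> simp [Function.update_apply, h, hrB]
        · by_cases h : i = i1
          · subst h
            rw [Function.update_self, ← hi1]
            exact fun h => hi2 (hri h)
          · rw [Function.update_of_ne h, ← hi1]
            exact fun h' => h (hri h')
      · refine ⟨r ∘ Equiv.swap i1 i2, Function.update s i1 z, Q.d, fun i => hrD _, hcD, Q.mem,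
          fun i => ?_, fun y _ => load_alpha (B := B) (hri.comp (Equiv.injective _))
            (fun i => hrB _) Q.inj Q.notMem (i1 := i1) (i2 := i2) ?_ y⟩
        · by_cases h : i = i1
          · subst h
            simpa using hz
          · rw [Function.update_of_ne h]
            by_cases h' : i = i2
            · subst h'
              have := (hs i).self
              simp only [Function.comp, Equiv.swap_apply_right, hi1]
              rwa [hy0] at this ⊢
            · simp only [Function.comp, Equiv.swap_apply_of_ne_of_ne h h']
              exact hs i
        · rw [Function.update_self, Function.update_of_ne hi2, hy0]
          exact hzy
    · push Not at hyr
      exact ⟨r, s, Q.d, hrD, hcD, Q.mem, hs,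
        fun y _ => load_beta hm hrB Q.inj Q.notMem hy0 hyB hyr y⟩
  · let c : Fin b → β := fun j => if Q.d j = y0 then r z0 else Q.d j
    have hci : Function.Injective c := by
      intro i j hij
      have h1 := Q.notMem i
      have h2 := Q.notMem j
      have h3 := hrB z0
      apply Q.inj
      simp only [c] at hij
      split_ifs at hij with u v v
      · rw [u, v]
      · exact (h2 (hij ▸ h3)).elim
      · exact (h1 (hij ▸ h3)).elim
      · exact hij
    refine ⟨r, s, c, hrD, fun j => ?_, fun j => ?_, hs, fun y _ => ?_⟩
    · simp only [c]
      split_ifs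
      · exact hrD _
      · exact hcD _
    · simp only [c]
      split_ifs
      · exact Q.sub _ (hrB _)
      · exact Q.mem _
    · by_cases hyy : y = y0
      · subst hyy
        have h1 := fiber_zero (f := r) (y := y) (fun j h => hyB (h ▸ hrB j))
        have h2 := fiber_zero (f := c) (y := y) (fun j h => by
          simp only [c] at h
          split_ifs at h with u
          · exact hyB (h ▸ hrB z0)
          · exact u h)
        have h3 := fiber_le s y
        omega
      · have h1 := fiber_le_one hri y
        have h2 := fiber_le_one hci y
        have := fiber_zero (f := s) (y := y) (fun j h => hyy (h ▸ hy0 j))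
        omega

/-- all columns hit, some row not hit -/
theorem caseII' {α β : Type*} [Fintype α] [Fintype β] [DecidableEq α] [DecidableEq β]
    {G : SimpleGraph α}
    {H : SimpleGraph β} {A : Finset α} {B : Finset β} {k a b : ℕ} (hk : 2 ≤ k)
    (P : Pack G A (k / 2) a) (Q : Pack H B (k / 2) b) (hB : B.card = k)
    (S : Finset (α × β)) (hS : S.card = k)
    (hSA : S.image Prod.fst = A) (hSB : S.image Prod.snd ⊆ B) (hA : A.card = k) :
    HasF (G □ H) (S : Set (α × β)) ((k / 2 + k / 2) + (a + b)) := by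
  classical
  have hinj : Set.InjOn Prod.fst (S : Set (α × β)) :=
    Finset.card_image_iff.1 (by rw [hSA, hA, hS])
  have hfst : ∀ x y, (x, y) ∈ (S : Set (α × β)) → x ∈ A := fun x y h =>
    hSA ▸ Finset.mem_image_of_mem Prod.fst h
  have hsnd : ∀ x y, (x, y) ∈ (S : Set (α × β)) → y ∈ S.image Prod.snd := fun x y h =>
    Finset.mem_image_of_mem Prod.snd h
  have hSne : S.Nonempty := Finset.card_pos.1 (by omega)
  by_cases h1 : ∃ g0 h0, (g0, h0) ∈ S ∧ ∀ x, (x, h0) ∈ S → x = g0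
  · obtain ⟨g0, h0, hm, hu⟩ := h1
    exact caseI (by omega) P Q hfst (fun x y h => hSB (hsnd x y h)) g0 h0 (hfst _ _ hm)
      (hSB (hsnd _ _ hm)) (fun y hy => (Prod.ext_iff.1 (hinj hy hm rfl)).2) hu
  · push Not at h1
    have h2 : 2 * (S.image Prod.snd).card ≤ k := by
      rw [← hS]
      apply Finset.mul_card_image_le_card_of_maps_to (f := Prod.snd)
      · intro p hp
        exact Finset.mem_image_of_mem Prod.snd hp
      · intro y hy
        obtain ⟨⟨x, y'⟩, hxy, rfl⟩ := Finset.mem_image.1 hy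
        obtain ⟨x', hx', hne⟩ := h1 x y' hxy
        apply Finset.one_lt_card.2
        exact ⟨(x, y'), by simp [hxy], (x', y'), by simp [hx'], by simpa using hne.symm⟩
    have h3 : (B \ S.image Prod.snd).card = k - (S.image Prod.snd).card := by
      rw [Finset.card_sdiff_of_subset hSB, hB]
    obtain ⟨r, s, c, hr, hc, hcX, hg, hl⟩ := exists_load (by omega) Q (S.image Prod.snd) hSB
      (hSne.image _) (by omega) (by omega)
    have : ∀ x, ∃ y, ∀ y', (x, y') ∈ S → y = y' := fun x => by
      by_cases h : ∃ y, (x, y) ∈ S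
      · obtain ⟨y, hy⟩ := h
        exact ⟨y, fun y' hy' => (Prod.ext_iff.1 (hinj hy hy' rfl)).2⟩
      · push Not at h
        obtain ⟨p, _⟩ := hSne
        exact ⟨p.2, fun y' hy' => (h y' hy').elim⟩
    choose hf hhf using this
    obtain ⟨⟨g0, h0⟩, hp⟩ := hSne
    exact caseII (by omega) P Q (S.image Prod.snd) hSB hfst hsnd
      (fun y hy => by
        obtain ⟨⟨x, y'⟩, hxy, rfl⟩ := Finset.mem_image.1 hy
        exact ⟨x, hxy⟩) hf hhf g0 (hfst _ _ hp) h0 (hsnd _ _ hp) r s c hr hc hcX hg hl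

theorem main {α β : Type*} [Fintype α] [Fintype β] {G : SimpleGraph α}
    {H : SimpleGraph β} {k : ℕ} (hk : 2 ≤ k)
    (hcA : k ≤ Fintype.card α) (hcB : k ≤ Fintype.card β)
    (h1 : k / 2 ≤ genLambda G k) (h2 : k / 2 ≤ genLambda H k)
    (S : Finset (α × β)) (hS : S.card = k) :
    HasF (G □ H) (S : Set (α × β)) (genLambda G k + genLambda H k) := by
  classical
  have hp : (S.image Prod.fst).card ≤ k := hS ▸ Finset.card_image_le
  have hq : (S.image Prod.snd).card ≤ k := hS ▸ Finset.card_image_le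
  obtain ⟨A, hSA, hA⟩ := Finset.exists_superset_card_eq hp hcA
  obtain ⟨B, hSB, hB⟩ := Finset.exists_superset_card_eq hq hcB
  obtain ⟨P⟩ := exists_pack hk hA (has_genLambda G hk A hA) h1
  obtain ⟨Q⟩ := exists_pack hk hB (has_genLambda H hk B hB) h2
  have e1 : genLambda G k + genLambda H k =
    (k / 2 + k / 2) + ((genLambda G k - k / 2) + (genLambda H k - k / 2)) := by omega
  by_cases hpk : (S.image Prod.fst).card = k
  · rw [e1]
    exact caseII' hk P Q hB S hS (Finset.eq_of_subset_of_card_le hSA (by omega)) hSB hA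
  by_cases hqk : (S.image Prod.snd).card = k
  · apply HasF.swap
    have e2 : genLambda G k + genLambda H k =
      (k / 2 + k / 2) + ((genLambda H k - k / 2) + (genLambda G k - k / 2)) := by omega
    rw [e2]
    have hpre : Prod.swap ⁻¹' (S : Set (α × β)) = (S.image Prod.swap : Finset (β × α)) := by
      ext ⟨x, y⟩
      simp
    rw [hpre]
    refine caseII' hk Q P hA _ ?_ ?_ ?_ hB
    · rw [Finset.card_image_of_injective _ Prod.swap_injective, hS]
    · rw [Finset.image_image]
      exact Finset.eq_of_subset_of_card_le hSB (hB.trans hqk.symm).le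
    · rw [Finset.image_image]
      exact hSA
  · rw [e1]
    have hfst : ∀ x y, (x, y) ∈ (S : Set (α × β)) → x ∈ S.image Prod.fst := fun x y h =>
      Finset.mem_image_of_mem Prod.fst h
    have hsnd : ∀ x y, (x, y) ∈ (S : Set (α × β)) → y ∈ S.image Prod.snd := fun x y h =>
      Finset.mem_image_of_mem Prod.snd h
    obtain ⟨g0, hg0, hg0'⟩ := Finset.exists_mem_notMem_of_card_lt_card
      (s := S.image Prod.fst) (t := A) (by omega)
    obtain ⟨h0, hh0, hh0'⟩ := Finset.exists_mem_notMem_of_card_lt_card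
      (s := S.image Prod.snd) (t := B) (by omega)
    exact caseI (by omega) P Q (fun x y h => hSA (hfst x y h)) (fun x y h => hSB (hsnd x y h))
      g0 h0 hg0 hh0 (fun y hy => (hg0' (hfst _ _ hy)).elim) (fun x hx => (hh0' (hsnd _ _ hx)).elim)

end S5

/-- if λ_k(H) ≥ λ_k(G) ≥ ⌊k/2⌋ then λ_k(G □ H) ≥ λ_k(G) + λ_k(H). -/
theorem stmt5 {α β : Type*} [Fintype α] [Fintype β]
    (G : SimpleGraph α) (H : SimpleGraph β) (k : ℕ) (hk : 2 ≤ k)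
    (hG : G.Connected) (hH : H.Connected)
    (hcardG : k + 1 ≤ Fintype.card α) (hcardH : k + 1 ≤ Fintype.card β)
    (h1 : k / 2 ≤ genLambda G k) (h2 : genLambda G k ≤ genLambda H k) :
    genLambda G k + genLambda H k ≤ genLambda (G □ H) k := by
  have hc : k ≤ Fintype.card (α × β) := by
    rw [Fintype.card_prod]
    nlinarith
  exact S5.le_genLambda (G □ H) hk hc
    (fun S hS => S5.main hk (by omega) (by omega) h1 (h1.trans h2) S hS)
end

section
/- For integers m ≥ n ≥ 3 and ⌈(2mn+3)/3⌉ < k ≤ mn, the generalized k-edge-connectivity of the torus satisfies λ_k(C_m □ C_n) = 2. -/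
open SimpleGraph

namespace Torus

/-- cyclic successor on values -/
def csucc (N a b : ℕ) : Prop := a + 1 = b ∨ (a + 1 = N ∧ b = 0)

lemma cyc_adj {N : ℕ} (hN : 3 ≤ N) {a b : Fin N} (h : csucc N a b) : (cycleGraph N).Adj a b := by
  rw [cycleGraph_adj']
  right
  rw [Fin.val_sub]
  have ha := a.2
  have hb := b.2
  rcases h with h | ⟨h, h'⟩
  · have : N - a.1 + b.1 = 1 + N := by omega
    rw [this, Nat.add_mod_right, Nat.mod_eq_of_lt (by omega)]
  · have : N - a.1 + b.1 = 1 := by omega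
    rw [this, Nat.mod_eq_of_lt (by omega)]

/-- first family of edges: columns, each minus one edge, with connecting row edges -/
def R1 (m n : ℕ) (u v : Fin m × Fin n) : Prop :=
  (u.1.1 = v.1.1 ∧ csucc n u.2.1 v.2.1 ∧ u.2.1 ≠ min u.1.1 (n - 2)) ∨
  (u.2.1 = v.2.1 ∧ u.1.1 + 1 = v.1.1 ∧ u.2.1 = min u.1.1 (n - 1))

/-- second family of edges: the complement -/
def R2 (m n : ℕ) (u v : Fin m × Fin n) : Prop :=
  (u.2.1 = v.2.1 ∧ csucc m u.1.1 v.1.1 ∧ ¬ (u.1.1 + 1 = v.1.1 ∧ u.2.1 = min u.1.1 (n - 1))) ∨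
  (u.1.1 = v.1.1 ∧ u.2.1 + 1 = v.2.1 ∧ u.2.1 = min u.1.1 (n - 2))

lemma fromRel_le {V : Type*} {G : SimpleGraph V} {R : V → V → Prop}
    (h : ∀ u v, R u v → G.Adj u v) : SimpleGraph.fromRel R ≤ G := by
  intro u v huv
  rw [SimpleGraph.fromRel_adj] at huv
  rcases huv.2 with h1 | h1
  · exact h _ _ h1
  · exact (h _ _ h1).symm

lemma R1_adj {m n : ℕ} (hm : 3 ≤ m) (hn : 3 ≤ n) (u v : Fin m × Fin n) (h : R1 m n u v) :
    (cycleGraph m □ cycleGraph n).Adj u v := by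
  rw [boxProd_adj]
  rcases h with ⟨h1, h2, -⟩ | ⟨h1, h2, -⟩
  · exact Or.inr ⟨cyc_adj hn h2, Fin.ext h1⟩
  · exact Or.inl ⟨cyc_adj hm (Or.inl h2), Fin.ext h1⟩

lemma R2_adj {m n : ℕ} (hm : 3 ≤ m) (hn : 3 ≤ n) (u v : Fin m × Fin n) (h : R2 m n u v) :
    (cycleGraph m □ cycleGraph n).Adj u v := by
  rw [boxProd_adj]
  rcases h with ⟨h1, h2, -⟩ | ⟨h1, h2, -⟩
  · exact Or.inl ⟨cyc_adj hm h2, Fin.ext h1⟩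
  · exact Or.inr ⟨cyc_adj hn (Or.inl h2), Fin.ext h1⟩

lemma R_disj {m n : ℕ} (hm : 3 ≤ m) (hn : 3 ≤ n) (u v : Fin m × Fin n) (h : R1 m n u v) :
    ¬ R2 m n u v ∧ ¬ R2 m n v u := by
  unfold R1 csucc at h
  unfold R2 csucc
  omega

lemma H_disj {m n : ℕ} (hm : 3 ≤ m) (hn : 3 ≤ n) :
    Disjoint (SimpleGraph.fromRel (R1 m n)) (SimpleGraph.fromRel (R2 m n)) := by
  rw [disjoint_left]
  intro u v h1 h2
  rw [SimpleGraph.fromRel_adj] at h1 h2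
  rcases h1.2 with h | h
  · have := R_disj hm hn _ _ h
    tauto
  · have := R_disj hm hn _ _ h
    tauto

lemma seg {V : Type*} (H : SimpleGraph V) (f : ℕ → V) (a b : ℕ) (hab : a ≤ b)
    (h : ∀ c, a ≤ c → c < b → H.Adj (f c) (f (c + 1))) : H.Reachable (f a) (f b) := by
  induction b, hab using Nat.le_induction with
  | base => exact Reachable.refl _
  | succ b hab ih =>
    exact (ih fun c h1 h2 => h c h1 (by omega)).trans (h b hab (by omega)).reachable

/-- vertex with given coordinates -/
def vx (m n : ℕ) [NeZero m] [NeZero n] (a b : ℕ) : Fin m × Fin n := (Fin.ofNat m a, Fin.ofNat n b)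

lemma vx_eq (m n : ℕ) [NeZero m] [NeZero n] (u : Fin m × Fin n) : vx m n u.1 u.2 = u := by
  simp [vx]

lemma rel_adj {m n : ℕ} [NeZero m] [NeZero n] {R : Fin m × Fin n → Fin m × Fin n → Prop}
    {a b c d : ℕ} (ha : a < m) (hb : b < n) (hc : c < m) (hd : d < n) (hne : a ≠ c ∨ b ≠ d)
    (h : R (vx m n a b) (vx m n c d)) :
    (SimpleGraph.fromRel R).Adj (vx m n a b) (vx m n c d) := by
  rw [SimpleGraph.fromRel_adj]
  refine ⟨?_, Or.inl h⟩
  intro he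
  have h1 := congrArg (fun x => x.1.1) he
  have h2 := congrArg (fun x => x.2.1) he
  simp only [vx, Fin.val_ofNat, Nat.mod_eq_of_lt ha, Nat.mod_eq_of_lt hb, Nat.mod_eq_of_lt hc,
    Nat.mod_eq_of_lt hd] at h1 h2
  omega

lemma adj1 {m n : ℕ} [NeZero m] [NeZero n]
    {a b c d : ℕ} (ha : a < m) (hb : b < n) (hc : c < m) (hd : d < n) (hne : a ≠ c ∨ b ≠ d)
    (h : (a = c ∧ csucc n b d ∧ b ≠ min a (n - 2)) ∨
      (b = d ∧ a + 1 = c ∧ b = min a (n - 1))) :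
    (SimpleGraph.fromRel (R1 m n)).Adj (vx m n a b) (vx m n c d) := by
  apply rel_adj ha hb hc hd hne
  simpa only [R1, vx, Fin.val_ofNat, Nat.mod_eq_of_lt ha, Nat.mod_eq_of_lt hb,
    Nat.mod_eq_of_lt hc, Nat.mod_eq_of_lt hd] using h

lemma adj2 {m n : ℕ} [NeZero m] [NeZero n]
    {a b c d : ℕ} (ha : a < m) (hb : b < n) (hc : c < m) (hd : d < n) (hne : a ≠ c ∨ b ≠ d)
    (h : (b = d ∧ csucc m a c ∧ ¬ (a + 1 = c ∧ b = min a (n - 1))) ∨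
      (a = c ∧ b + 1 = d ∧ b = min a (n - 2))) :
    (SimpleGraph.fromRel (R2 m n)).Adj (vx m n a b) (vx m n c d) := by
  apply rel_adj ha hb hc hd hne
  simpa only [R2, vx, Fin.val_ofNat, Nat.mod_eq_of_lt ha, Nat.mod_eq_of_lt hb,
    Nat.mod_eq_of_lt hc, Nat.mod_eq_of_lt hd] using h

lemma H1_conn {m n : ℕ} (hm : 3 ≤ m) (hn : 3 ≤ n) : (SimpleGraph.fromRel (R1 m n)).Connected := by
  have : NeZero m := ⟨by omega⟩
  have : NeZero n := ⟨by omega⟩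
  have col : ∀ i < m, ∀ j < n,
      (SimpleGraph.fromRel (R1 m n)).Reachable (vx m n i 0) (vx m n i j) := by
    intro i hi j hj
    by_cases hc : j ≤ min i (n - 2)
    · exact seg _ (fun c => vx m n i c) 0 j (by omega) fun c _ h2 =>
        adj1 hi (by omega) hi (by omega) (by omega) (by unfold csucc; omega)
    · have h1 := seg (SimpleGraph.fromRel (R1 m n)) (fun c => vx m n i c) j (n - 1) (by omega)
        fun c _ h2 => adj1 hi (by omega) hi (by omega) (by omega) (by unfold csucc; omega)
      have h2 : (SimpleGraph.fromRel (R1 m n)).Adj (vx m n i (n - 1)) (vx m n i 0) :=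
        adj1 hi (by omega) hi (by omega) (by omega) (by unfold csucc; omega)
      exact (h1.trans h2.reachable).symm
  have base : ∀ i, i < m →
      (SimpleGraph.fromRel (R1 m n)).Reachable (vx m n 0 0) (vx m n i 0) := by
    intro i
    induction i with
    | zero => intro _; exact Reachable.refl _
    | succ i ih =>
      intro hi
      have h2 : (SimpleGraph.fromRel (R1 m n)).Adj (vx m n i (min i (n - 1)))
          (vx m n (i + 1) (min i (n - 1))) :=
        adj1 (by omega) (by omega) hi (by omega) (by omega) (by omega)
      exact (((ih (by omega)).trans (col i (by omega) (min i (n - 1)) (by omega))).trans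
        h2.reachable).trans (col (i + 1) hi (min i (n - 1)) (by omega)).symm
  rw [connected_iff_exists_forall_reachable]
  refine ⟨vx m n 0 0, fun u => ?_⟩
  rw [← vx_eq m n u]
  exact (base _ u.1.2).trans (col _ u.1.2 _ u.2.2)

lemma H2_conn {m n : ℕ} (hm : n ≤ m) (hn : 3 ≤ n) :
    (SimpleGraph.fromRel (R2 m n)).Connected := by
  have : NeZero m := ⟨by omega⟩
  have : NeZero n := ⟨by omega⟩
  have row1 : ∀ j < n, ∀ i ≤ j,
      (SimpleGraph.fromRel (R2 m n)).Reachable (vx m n 0 j) (vx m n i j) := by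
    intro j hj i hi
    exact seg _ (fun c => vx m n c j) 0 i (by omega) fun c _ h2 =>
        adj2 (by omega) (by omega) (by omega) (by omega) (by omega) (by unfold csucc; omega)
  have row2 : ∀ j < n - 1, ∀ i < m,
      (SimpleGraph.fromRel (R2 m n)).Reachable (vx m n 0 j) (vx m n i j) := by
    intro j hj i hi
    by_cases hc : i ≤ j
    · exact row1 j (by omega) i hc
    · have h1 := seg (SimpleGraph.fromRel (R2 m n)) (fun c => vx m n c j) i (m - 1) (by omega)
        fun c _ h2 => adj2 (by omega) (by omega) (by omega) (by omega) (by omega)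
          (by unfold csucc; omega)
      have h2 : (SimpleGraph.fromRel (R2 m n)).Adj (vx m n (m - 1) j) (vx m n 0 j) :=
        adj2 (by omega) (by omega) (by omega) (by omega) (by omega) (by unfold csucc; omega)
      exact (h1.trans h2.reachable).symm
  have base : ∀ j, j < n →
      (SimpleGraph.fromRel (R2 m n)).Reachable (vx m n 0 0) (vx m n 0 j) := by
    intro j
    induction j with
    | zero => intro _; exact Reachable.refl _
    | succ j ih =>
      intro hj
      have h2 : (SimpleGraph.fromRel (R2 m n)).Adj (vx m n j j) (vx m n j (j + 1)) :=
        adj2 (by omega) (by omega) (by omega) (by omega) (by omega) (by omega)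
      exact (((ih (by omega)).trans (row1 j (by omega) j (by omega))).trans
        h2.reachable).trans (row1 (j + 1) hj j (by omega)).symm
  rw [connected_iff_exists_forall_reachable]
  refine ⟨vx m n 0 0, fun u => ?_⟩
  rw [← vx_eq m n u]
  obtain ⟨⟨i, hi⟩, ⟨j, hj⟩⟩ := u
  simp only
  by_cases h1 : j < n - 1
  · exact (base _ hj).trans (row2 _ h1 _ hi)
  by_cases h2 : i ≤ j
  · exact (base _ hj).trans (row1 _ hj _ h2)
  · have h3 : (SimpleGraph.fromRel (R2 m n)).Adj (vx m n i (j - 1)) (vx m n i j) :=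
      adj2 (by omega) (by omega) (by omega) (by omega) (by omega) (by omega)
    exact ((base (j - 1) (by omega)).trans (row2 _ (by omega) i hi)).trans h3.reachable

lemma steiner_of_conn {V : Type*} [Finite V] {G H : SimpleGraph V} (hle : H ≤ G)
    (hc : H.Connected) (S : Set V) :
    ∃ T : G.Subgraph, IsSteinerTree G S T ∧ T.edgeSet ⊆ H.edgeSet := by
  obtain ⟨T, hT, ht⟩ := hc.exists_isTree_le
  refine ⟨SimpleGraph.toSubgraph T (hT.trans hle), ⟨fun v _ => Set.mem_univ v, ?_⟩, ?_⟩
  · have e := Subgraph.spanningCoeEquivCoeOfSpanning _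
      (SimpleGraph.toSubgraph.isSpanning T (hT.trans hle))
    exact e.isTree_iff.1 ht
  · intro e
    induction e using Sym2.ind with | h a b =>
    intro h
    exact hT h

lemma has_two {m n : ℕ} (hmn : n ≤ m) (hn : 3 ≤ n) (S : Set (Fin m × Fin n)) :
    HasEDSteinerTrees (cycleGraph m □ cycleGraph n) S 2 := by
  have hm : 3 ≤ m := hn.trans hmn
  obtain ⟨T1, h1, e1⟩ := steiner_of_conn (fromRel_le (R1_adj hm hn)) (H1_conn hm hn) S
  obtain ⟨T2, h2, e2⟩ := steiner_of_conn (fromRel_le (R2_adj hm hn)) (H2_conn hmn hn) S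
  have hd : Disjoint T1.edgeSet T2.edgeSet :=
    Set.disjoint_of_subset e1 e2 (disjoint_edgeSet.2 (H_disj hm hn))
  refine ⟨![T1, T2], ?_, ?_⟩
  · intro i
    fin_cases i
    · exact h1
    · exact h2
  · intro i j hij
    fin_cases i <;> fin_cases j
    · exact absurd rfl hij
    · exact hd
    · exact hd.symm
    · exact absurd rfl hij

lemma cyc_degree {N : ℕ} (hN : 3 ≤ N) (v : Fin N) [Fintype ((cycleGraph N).neighborSet v)] :
    (cycleGraph N).degree v = 2 := by
  obtain ⟨N, rfl⟩ := Nat.exists_eq_add_of_le' hN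
  rw [← cycleGraph_degree_three_le (v := v)]
  congr!

lemma edge_count {m n : ℕ} (hm : 3 ≤ m) (hn : 3 ≤ n) :
    (cycleGraph m □ cycleGraph n).edgeSet.ncard = 2 * (m * n) := by
  classical
  have h := sum_degrees_eq_twice_card_edges (cycleGraph m □ cycleGraph n)
  rw [Finset.sum_congr rfl (g := fun _ => 4) fun x _ => by
    rw [degree_boxProd, cyc_degree hm, cyc_degree hn]] at h
  simp only [Finset.sum_const, Finset.card_univ, Fintype.card_prod, Fintype.card_fin,
    smul_eq_mul] at h
  rw [← coe_edgeFinset, Set.ncard_coe_finset]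
  omega

lemma tree_edges {V : Type*} [Finite V] {G : SimpleGraph V} {S : Set V} {T : G.Subgraph}
    (h : IsSteinerTree G S T) : S.ncard ≤ T.edgeSet.ncard + 1 := by
  have h1 := h.2.connected.card_vert_le_card_edgeSet_add_one
  have h2 : T.edgeSet.ncard = T.coe.edgeSet.ncard := by
    rw [← Subgraph.image_coe_edgeSet_coe]
    exact Set.ncard_image_of_injective _ (Sym2.map.injective Subtype.val_injective)
  have h3 := Set.ncard_le_ncard h.1 (Set.toFinite _)
  rw [Nat.card_coe_set_eq, Nat.card_coe_set_eq] at h1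
  omega

lemma upper {V : Type*} [Finite V] {G : SimpleGraph V} {S : Set V} {N : ℕ}
    (h : HasEDSteinerTrees G S N) (hN : 3 ≤ N) : 3 * S.ncard ≤ G.edgeSet.ncard + 3 := by
  obtain ⟨f, hf, hd⟩ := h
  let a : Fin N := ⟨0, by omega⟩
  let b : Fin N := ⟨1, by omega⟩
  let c : Fin N := ⟨2, by omega⟩
  have hab := hd a b (by simp [a, b])
  have hac := hd a c (by simp [a, c])
  have hbc := hd b c (by simp [b, c])
  have ha := tree_edges (hf a)
  have hb := tree_edges (hf b)
  have hc := tree_edges (hf c)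
  have h1 := Set.ncard_union_eq hab (Set.toFinite _) (Set.toFinite _)
  have h2 := Set.ncard_union_eq (Set.disjoint_union_left.2 ⟨hac, hbc⟩)
    (Set.toFinite _) (Set.toFinite _)
  have h3 : ((f a).edgeSet ∪ (f b).edgeSet ∪ (f c).edgeSet).ncard ≤ G.edgeSet.ncard :=
    Set.ncard_le_ncard (Set.union_subset (Set.union_subset (f a).edgeSet_subset
      (f b).edgeSet_subset) (f c).edgeSet_subset) (Set.toFinite _)
  omega

end Torus

/-- for m ≥ n ≥ 3 and ⌈(2mn+3)/3⌉ < k ≤ mn, λ_k(C_m □ C_n) = 2.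
    Here ⌈(2mn+3)/3⌉ = (2mn+5)/3 in natural-number division. -/
theorem stmt12 (m n k : ℕ) (hn : 3 ≤ n) (hmn : n ≤ m)
    (hk : (2 * m * n + 5) / 3 < k) (hkmn : k ≤ m * n) :
    genLambda (cycleGraph m □ cycleGraph n) k = 2 := by
  have key : ∀ S : Finset (Fin m × Fin n), S.card = k →
      steinerLambda (cycleGraph m □ cycleGraph n) ↑S = 2 := by
    intro S hS
    have hub : ∀ N ∈ {N | HasEDSteinerTrees (cycleGraph m □ cycleGraph n) (↑S) N}, N ≤ 2 := by
      intro N hN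
      by_contra hlt
      have h := Torus.upper hN (by omega)
      rw [Torus.edge_count (by omega) hn, Set.ncard_coe_finset, hS] at h
      rw [mul_assoc] at hk
      omega
    exact IsGreatest.csSup_eq ⟨Torus.has_two hmn hn _, hub⟩
  have hset : {x | ∃ S : Finset (Fin m × Fin n), S.card = k ∧
      steinerLambda (cycleGraph m □ cycleGraph n) ↑S = x} = {2} := by
    ext x
    constructor
    · rintro ⟨S, hS, rfl⟩
      exact key S hS
    · rintro rfl
      obtain ⟨S, -, hS⟩ := Finset.exists_subset_card_eq
        (s := (Finset.univ : Finset (Fin m × Fin n))) (n := k) (by simpa using hkmn)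
      exact ⟨S, hS, key S hS⟩
  unfold genLambda
  rw [hset, csInf_singleton]
end
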